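/- arXiv:math/0302284 — 3 statements merged into one kernel-verified Lean document; each statement's English description precedes it below -/
import Mathlib

section
/- Let X and Y be S-cofibrant flows and let f : X → Y be a morphism of flows. Then f is a weak S-homotopy equivalence if and only if f is an S-homotopy equivalence (Whitehead theorem for flows). -/
open CategoryTheory

namespace Gaucher

/-- Helper: any map out of an empty space is continuous. -/
theorem continuous_of_isEmpty {α β : Type*} [TopologicalSpace α] [TopologicalSpace β]
    [IsEmpty α] (f : α → β) : Continuous f :=
  ⟨fun s _ => by rw [Set.eq_empty_of_isEmpty (f ⁻¹' s)]; exact isOpen_empty⟩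

/-- Helper: fibers of constant maps are open. -/
theorem isOpen_preimage_const {α β : Type*} [TopologicalSpace α] (b a : β) :
    IsOpen ((fun _ : α => b) ⁻¹' {a}) := by
  rcases eq_or_ne b a with h | h
  · rw [Set.preimage_const_of_mem (by simpa using h)]; exact isOpen_univ
  · rw [Set.preimage_const_of_notMem (by simpa using h)]; exact isOpen_empty

/-- A flow (Gaucher): a set of states (with the discrete topology), a topological
space of (non-constant) execution paths, source and target maps which are continuous
(i.e. have open fibers, the state set being discrete), and a continuous, associative
partial composition defined on composable pairs of paths. -/
structure Flow : Type 1 where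
  /-- the `0`-skeleton, i.e. the set of states -/
  State : Type
  /-- the space of non-constant execution paths -/
  Path : Type
  [topPath : TopologicalSpace Path]
  /-- source map -/
  s : Path → State
  /-- target map -/
  t : Path → State
  isOpen_preimage_s : ∀ a : State, IsOpen (s ⁻¹' {a})
  isOpen_preimage_t : ∀ a : State, IsOpen (t ⁻¹' {a})
  /-- composition of composable paths -/
  comp : ∀ x y : Path, t x = s y → Path
  continuous_comp : Continuous (fun p : { p : Path × Path // t p.1 = s p.2 } =>
    comp p.1.1 p.1.2 p.2)
  s_comp : ∀ x y h, s (comp x y h) = s x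
  t_comp : ∀ x y h, t (comp x y h) = t y
  comp_assoc : ∀ (x y z : Path) (hxy : t x = s y) (hyz : t y = s z)
    (h₁ : t x = s (comp y z hyz)) (h₂ : t (comp x y hxy) = s z),
    comp x (comp y z hyz) h₁ = comp (comp x y hxy) z h₂

attribute [instance] Flow.topPath

/-- The state set of a flow carries the discrete topology. -/
instance Flow.topState (X : Flow) : TopologicalSpace X.State := ⊥

instance (X : Flow) : DiscreteTopology X.State := ⟨rfl⟩

/-- A morphism of flows: a map preserving states, paths, sources, targets and
composition, continuous on the path spaces (continuity on the discrete state part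
being automatic). -/
structure FlowHom (X Y : Flow) : Type where
  toFun0 : X.State → Y.State
  toFunP : X.Path → Y.Path
  continuous_toFunP : Continuous toFunP
  s_map : ∀ x, Y.s (toFunP x) = toFun0 (X.s x)
  t_map : ∀ x, Y.t (toFunP x) = toFun0 (X.t x)
  comp_map : ∀ x y (h : X.t x = X.s y) (h' : Y.t (toFunP x) = Y.s (toFunP y)),
    toFunP (X.comp x y h) = Y.comp (toFunP x) (toFunP y) h'

theorem FlowHom.ext {X Y : Flow} {f g : FlowHom X Y}
    (h0 : f.toFun0 = g.toFun0) (hP : f.toFunP = g.toFunP) : f = g := by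
  cases f; cases g; cases h0; cases hP; rfl

/-- The identity morphism of flows. -/
def FlowHom.id (X : Flow) : FlowHom X X where
  toFun0 := _root_.id
  toFunP := _root_.id
  continuous_toFunP := continuous_id
  s_map _ := rfl
  t_map _ := rfl
  comp_map _ _ _ _ := rfl

/-- Composition of morphisms of flows (`g.comp f` is `g ∘ f`). -/
def FlowHom.comp {X Y Z : Flow} (g : FlowHom Y Z) (f : FlowHom X Y) : FlowHom X Z where
  toFun0 := g.toFun0 ∘ f.toFun0
  toFunP := g.toFunP ∘ f.toFunP
  continuous_toFunP := g.continuous_toFunP.comp f.continuous_toFunP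
  s_map x := by simp only [Function.comp_apply, g.s_map, f.s_map]
  t_map x := by simp only [Function.comp_apply, g.t_map, f.t_map]
  comp_map x y h h' := by
    have hY : Y.t (f.toFunP x) = Y.s (f.toFunP y) := by
      rw [f.t_map, f.s_map, h]
    show g.toFunP (f.toFunP (X.comp x y h)) = _
    rw [f.comp_map x y h hY, g.comp_map _ _ hY h']
    rfl

/-- The category `Flow` of flows. -/
instance : Category Flow where
  Hom := FlowHom
  id := FlowHom.id
  comp f g := g.comp f
  id_comp f := FlowHom.ext rfl rfl
  comp_id f := FlowHom.ext rfl rfl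
  assoc f g h := FlowHom.ext rfl rfl

theorem FlowHom.comp_assoc {W X Y Z : Flow} (h : FlowHom Y Z) (g : FlowHom X Y)
    (f : FlowHom W X) : (h.comp g).comp f = h.comp (g.comp f) :=
  FlowHom.ext rfl rfl

/-- The flow `Glob Z` associated to a topological space `Z`: two states `0` and `1`,
path space `Z`, every path going from `0` to `1` (no two paths are composable). -/
def Glob (Z : Type) [TopologicalSpace Z] : Flow where
  State := Fin 2
  Path := Z
  s := fun _ => 0
  t := fun _ => 1
  isOpen_preimage_s := fun a => isOpen_preimage_const _ a
  isOpen_preimage_t := fun a => isOpen_preimage_const _ a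
  comp := fun _ _ h => absurd (show (1 : Fin 2) = 0 from h) (by decide)
  continuous_comp := by
    haveI : IsEmpty { p : Z × Z // (fun _ : Z => (1 : Fin 2)) p.1 = (fun _ : Z => (0 : Fin 2)) p.2 } :=
      ⟨fun p => absurd (show (1 : Fin 2) = 0 from p.2) (by decide)⟩
    exact continuous_of_isEmpty _
  s_comp := fun x y h => absurd (show (1 : Fin 2) = 0 from h) (by decide)
  t_comp := fun x y h => absurd (show (1 : Fin 2) = 0 from h) (by decide)
  comp_assoc := fun x y z hxy => absurd (show (1 : Fin 2) = 0 from hxy) (by decide)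

/-- Functoriality of `Glob`. -/
def Glob.map {Z W : Type} [TopologicalSpace Z] [TopologicalSpace W] (f : C(Z, W)) :
    FlowHom (Glob Z) (Glob W) where
  toFun0 := _root_.id
  toFunP := f
  continuous_toFunP := f.continuous
  s_map _ := rfl
  t_map _ := rfl
  comp_map x y h := absurd (show (1 : Fin 2) = 0 from h) (by decide)

/-- The directed segment `I⃗` is `Glob` of a one-point space. -/
def dirSegment : Flow := Glob PUnit

/-- The flow with exactly one state and no non-constant execution path. -/
def pointFlow : Flow where
  State := PUnit
  Path := Empty
  s := fun e => e.elim
  t := fun e => e.elim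
  isOpen_preimage_s := fun a => by
    rw [Set.eq_empty_of_isEmpty (_ ⁻¹' {a})]; exact isOpen_empty
  isOpen_preimage_t := fun a => by
    rw [Set.eq_empty_of_isEmpty (_ ⁻¹' {a})]; exact isOpen_empty
  comp := fun x _ _ => x.elim
  continuous_comp := continuous_of_isEmpty _
  s_comp := fun x => x.elim
  t_comp := fun x => x.elim
  comp_assoc := fun x => x.elim

-- PART B (appended after part A) : S-homotopy, weak homotopy equivalences

/-- Two morphisms of flows `f g : X → Y` are S-homotopic: there is a continuous map
`H : (X⁰ ⊔ ℙX) × [0,1] → Y⁰ ⊔ ℙY` such that every `H(-,u)` is a morphism of flows,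
`H(-,0) = f` and `H(-,1) = g`.  (Continuity of `H` on the two summands `ℙX × [0,1]`
and `X⁰ × [0,1]` — the state sets carrying the discrete topology — is exactly
continuity of the two maps below.) -/
def SHomotopy {X Y : Flow} (f g : FlowHom X Y) : Prop :=
  ∃ F : unitInterval → FlowHom X Y,
    F 0 = f ∧ F 1 = g ∧
    Continuous (fun p : X.Path × unitInterval => (F p.2).toFunP p.1) ∧
    Continuous (fun p : X.State × unitInterval => (F p.2).toFun0 p.1)

/-- A morphism of flows is an S-homotopy equivalence if it admits an inverse up to
S-homotopy. -/
def IsSHomotopyEquiv {X Y : Flow} (f : FlowHom X Y) : Prop :=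
  ∃ g : FlowHom Y X, SHomotopy (f.comp g) (FlowHom.id Y) ∧ SHomotopy (g.comp f) (FlowHom.id X)

/-- Two flows are S-homotopy equivalent. -/
def SHomotopyEquivalent (X Y : Flow) : Prop :=
  ∃ f : FlowHom X Y, IsSHomotopyEquiv f

/-- The underlying continuous map on path spaces of a morphism of flows. -/
def FlowHom.pathMap {X Y : Flow} (f : FlowHom X Y) : C(X.Path, Y.Path) :=
  ⟨f.toFunP, f.continuous_toFunP⟩

/-- The map induced by a continuous map on `π₀` (path components). -/
def pi0Map {A B : Type*} [TopologicalSpace A] [TopologicalSpace B] (h : C(A, B)) :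
    ZerothHomotopy A → ZerothHomotopy B :=
  Quotient.map h (fun _ _ j => ⟨j.somePath.map h.continuous⟩)

/-- Push forward a generalized loop along a continuous map. -/
def GenLoop.push {A B : Type*} [TopologicalSpace A] [TopologicalSpace B] (h : C(A, B))
    {N : Type*} {x : A} (p : GenLoop N A x) : GenLoop N B (h x) :=
  ⟨h.comp p.1, fun y hy => by
    simp only [ContinuousMap.comp_apply]
    exact congrArg h (p.2 y hy)⟩

/-- The map induced by a continuous map on the `N`-th homotopy group. -/
def piMap {A B : Type*} [TopologicalSpace A] [TopologicalSpace B] (h : C(A, B))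
    (N : Type*) (x : A) : HomotopyGroup N A x → HomotopyGroup N B (h x) :=
  Quotient.map (GenLoop.push h) (fun _ _ H =>
    ⟨(Nonempty.some H).compContinuousMap h⟩)

/-- A continuous map is a weak homotopy equivalence: it induces a bijection on path
components and, for every base point and every `n`, a bijection on `πₙ`. -/
def IsWeakHomotopyEquiv {A B : Type*} [TopologicalSpace A] [TopologicalSpace B]
    (h : C(A, B)) : Prop :=
  Function.Bijective (pi0Map h) ∧
    ∀ (x : A) (n : ℕ), Function.Bijective (piMap h (Fin n) x)

/-- A morphism of flows is a weak S-homotopy equivalence if it induces a bijection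
on the `0`-skeletons and a weak homotopy equivalence on the path spaces. -/
def IsWeakSHomotopyEquiv {X Y : Flow} (f : FlowHom X Y) : Prop :=
  Function.Bijective f.toFun0 ∧ IsWeakHomotopyEquiv f.pathMap

-- PART C : S-cofibrant flows

/-- The sphere `S^{n-1}`, boundary of the closed `n`-disk `D^n`. -/
abbrev diskBoundary (n : ℕ) : Type := Metric.sphere (0 : EuclideanSpace ℝ (Fin n)) 1

/-- The closed `n`-disk `D^n`. -/
abbrev closedDisk (n : ℕ) : Type := Metric.closedBall (0 : EuclideanSpace ℝ (Fin n)) 1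

/-- The inclusion `S^{n-1} ⊆ D^n`. -/
noncomputable def diskBoundaryInclusion (n : ℕ) : C(diskBoundary n, closedDisk n) :=
  ⟨fun p => ⟨p.1, Metric.sphere_subset_closedBall p.2⟩,
    Continuous.subtype_mk continuous_subtype_val _⟩

/-- The inclusion of flows `Glob (S^{n-1}) → Glob (D^n)`. -/
noncomputable def globBoundaryInclusion (n : ℕ) : FlowHom (Glob (diskBoundary n)) (Glob (closedDisk n)) :=
  Glob.map (diskBoundaryInclusion n)

/-- A witness that a flow `X` is S-cofibrant: a skeletal filtration `sk 0 → sk 1 → ⋯`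
where `sk 0` has empty path space (it is purely a discrete set of states), where
`sk (n+1)` is obtained from `sk n` as the pushout (expressed by its universal property,
`attach_isPushout`) of `⊔ᵢ Glob (S^{n-1}) → ⊔ᵢ Glob (D^n)` along attaching morphisms
`Glob (S^{n-1}) → sk n` (for `n = 0` this attaches copies of the directed segment
`I⃗ = Glob(D⁰)` along `Glob(S^{-1}) = Glob(∅)`), and where `X` is the colimit
(expressed by its universal property `isColimit`) of the `sk n`. -/
structure SCofibrantStructure (X : Flow) : Type 1 where
  sk : ℕ → Flow
  isEmpty_path_sk_zero : IsEmpty (sk 0).Path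
  ι : ∀ n, FlowHom (sk n) (sk (n + 1))
  cells : ℕ → Type
  attachMap : ∀ n, cells n → FlowHom (Glob (diskBoundary n)) (sk n)
  cellMap : ∀ n, cells n → FlowHom (Glob (closedDisk n)) (sk (n + 1))
  attach_comm : ∀ n (i : cells n),
    (cellMap n i).comp (globBoundaryInclusion n) = (ι n).comp (attachMap n i)
  attach_isPushout : ∀ n (Z : Flow) (g : FlowHom (sk n) Z)
    (k : cells n → FlowHom (Glob (closedDisk n)) Z),
    (∀ i, (k i).comp (globBoundaryInclusion n) = g.comp (attachMap n i)) →
    ∃! h : FlowHom (sk (n + 1)) Z, h.comp (ι n) = g ∧ ∀ i, h.comp (cellMap n i) = k i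
  incl : ∀ n, FlowHom (sk n) X
  incl_comm : ∀ n, (incl (n + 1)).comp (ι n) = incl n
  isColimit : ∀ (Z : Flow) (d : ∀ n, FlowHom (sk n) Z),
    (∀ n, (d (n + 1)).comp (ι n) = d n) →
    ∃! h : FlowHom X Z, ∀ n, h.comp (incl n) = d n

/-- A flow is S-cofibrant if it admits a skeletal filtration as above. -/
def SCofibrant (X : Flow) : Prop :=
  Nonempty (SCofibrantStructure X)

-- PART D : the flow U ⊠ X, S-cofibrations, NDR pairs, the space FLOW(X,Y)

/-- The data exhibiting a flow `B` as a candidate for `U ⊠ X` (`U` a topological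
space, `X` a flow): the generators, i.e. the states of `X` and a continuous family
`η (u, x)` of paths indexed by `U × ℙX`, subject to the defining relations
`s(u ⊠ x) = s x`, `t(u ⊠ x) = t x` and `(u ⊠ x) * (u ⊠ y) = u ⊠ (x * y)`. -/
structure BoxCocone (U : Type) [TopologicalSpace U] (X B : Flow) : Type where
  η0 : X.State → B.State
  η : U × X.Path → B.Path
  continuous_η : Continuous η
  s_η : ∀ u x, B.s (η (u, x)) = η0 (X.s x)
  t_η : ∀ u x, B.t (η (u, x)) = η0 (X.t x)
  comp_η : ∀ u x y (h : X.t x = X.s y) (h' : B.t (η (u, x)) = B.s (η (u, y))),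
    B.comp (η (u, x)) (η (u, y)) h' = η (u, X.comp x y h)

/-- `B`, equipped with the data `c`, *is* the flow `U ⊠ X`, i.e. the free flow
generated by `X⁰ ⊔ (U × ℙX)` quotiented by the relations `s (u,x) = s x`,
`t (u,x) = t x` and `(u,x) * (u,y) = (u, x*y)`: every flow `Z` equipped with such
data receives a unique morphism of flows from `B` compatible with the data. -/
def IsBoxTimes {U : Type} [TopologicalSpace U] {X B : Flow} (c : BoxCocone U X B) : Prop :=
  ∀ (Z : Flow) (d : BoxCocone U X Z),
    ∃! f : FlowHom B Z, f.toFun0 ∘ c.η0 = d.η0 ∧ f.toFunP ∘ c.η = d.η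

/-- For `u ∈ U`, the morphism of flows `X → U ⊠ X`, `x ↦ u ⊠ x`. -/
def BoxCocone.atTime {U : Type} [TopologicalSpace U] {X B : Flow}
    (c : BoxCocone U X B) (u : U) : FlowHom X B where
  toFun0 := c.η0
  toFunP := fun x => c.η (u, x)
  continuous_toFunP := c.continuous_η.comp (Continuous.prodMk_right u)
  s_map x := c.s_η u x
  t_map x := c.t_η u x
  comp_map x y h h' := (c.comp_η u x y h h').symm

/-- Given box-product data `c : BoxCocone U A BUA` and `c' : BoxCocone V X BVX`, a
continuous map `φ : U → V` and a morphism of flows `f : A → X`, this asserts that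
`m : BUA → BVX` is the canonically induced morphism `φ ⊠ f`, i.e. `u ⊠ a ↦ φ u ⊠ f a`. -/
def IsInducedBoxHom {U V : Type} [TopologicalSpace U] [TopologicalSpace V]
    {A X BUA BVX : Flow} (c : BoxCocone U A BUA) (c' : BoxCocone V X BVX)
    (φ : U → V) (f : FlowHom A X) (m : FlowHom BUA BVX) : Prop :=
  (∀ a, m.toFun0 (c.η0 a) = c'.η0 (f.toFun0 a)) ∧
  (∀ u x, m.toFunP (c.η (u, x)) = c'.η (φ u, f.toFunP x))

/-- A morphism of flows `i : A → X` is an S-cofibration if it satisfies the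
S-homotopy extension property: for every realization of `[0,1] ⊠ A` and `[0,1] ⊠ X`,
every morphism `g : X → Z` and every S-homotopy `H : [0,1] ⊠ A → Z` starting at
`g ∘ i`, there is an S-homotopy `H̄ : [0,1] ⊠ X → Z` with `H̄(u ⊠ i x) = H(u ⊠ x)`
and `H̄(0 ⊠ y) = g y`. -/
def IsSCofibration {A X : Flow} (i : FlowHom A X) : Prop :=
  ∀ (IA IX : Flow) (cA : BoxCocone unitInterval A IA) (cX : BoxCocone unitInterval X IX),
    IsBoxTimes cA → IsBoxTimes cX →
    ∀ (Z : Flow) (g : FlowHom X Z) (H : FlowHom IA Z),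
      H.comp (cA.atTime 0) = g.comp i →
      ∃ Hbar : FlowHom IX Z,
        (∀ u : unitInterval, (Hbar.comp ((cX.atTime u).comp i)) = H.comp (cA.atTime u)) ∧
        Hbar.comp (cX.atTime 0) = g

/-- `(Y, B)` is an NDR pair: `B` is closed in `Y` and there are `u : Y → [0,1]` with
`B = u⁻¹(0)` and a homotopy `h : Y × [0,1] → Y` with `h(y,0) = y`, `h(b,t) = b` for
`b ∈ B`, and `h(y,1) ∈ B` as soon as `u y < 1`. -/
def IsNDRPair {Y : Type} [TopologicalSpace Y] (B : Set Y) : Prop :=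
  IsClosed B ∧ ∃ (u : C(Y, unitInterval)) (h : C(Y × unitInterval, Y)),
    B = {y | u y = 0} ∧
    (∀ y, h (y, 0) = y) ∧
    (∀ b ∈ B, ∀ t, h (b, t) = b) ∧
    (∀ y, (u y : ℝ) < 1 → h (y, 1) ∈ B)

/-- `(Y, B)` is a DR pair: as for an NDR pair, but with `u y < 1` everywhere, so that
`B` is a deformation retract of `Y`. -/
def IsDRPair {Y : Type} [TopologicalSpace Y] (B : Set Y) : Prop :=
  IsClosed B ∧ ∃ (u : C(Y, unitInterval)) (h : C(Y × unitInterval, Y)),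
    B = {y | u y = 0} ∧
    (∀ y, h (y, 0) = y) ∧
    (∀ b ∈ B, ∀ t, h (b, t) = b) ∧
    (∀ y, (u y : ℝ) < 1 → h (y, 1) ∈ B) ∧
    (∀ y, (u y : ℝ) < 1)

/-- A morphism of flows, as a continuous map `X⁰ ⊔ ℙX → Y⁰ ⊔ ℙY`. -/
def FlowHom.toSumMap {X Y : Flow} (f : FlowHom X Y) :
    C(X.State ⊕ X.Path, Y.State ⊕ Y.Path) :=
  ⟨Sum.map f.toFun0 f.toFunP,
    (continuous_of_discreteTopology (α := X.State)).sumMap f.continuous_toFunP⟩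

/-- The set of morphisms of flows from `X` to `Y` carries the topology induced, via
`FlowHom.toSumMap`, by the compact-open topology. -/
def flowHomInducedTop (X Y : Flow) : TopologicalSpace (FlowHom X Y) :=
  TopologicalSpace.induced FlowHom.toSumMap ContinuousMap.compactOpen

/-- The space `FLOW(X,Y)`: morphisms of flows with the Kelleyfication of the induced
compact-open topology. -/
instance FlowHom.topologicalSpace (X Y : Flow) : TopologicalSpace (FlowHom X Y) :=
  @TopologicalSpace.compactlyGenerated.{0} (FlowHom X Y) (flowHomInducedTop X Y)

-- PART E : model structures, localization, limits machinery

/-- The class of weak S-homotopy equivalences, as a class of morphisms of the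
category `Flow`. -/
def weakSHomotopyEquivalences : MorphismProperty Flow :=
  fun _ _ f => IsWeakSHomotopyEquiv f

/-- `f` is a retract of `g` in the arrow category. -/
def IsRetractOfHom {C : Type*} [Category C] {X Y Z W : C} (f : X ⟶ Y) (g : Z ⟶ W) : Prop :=
  ∃ (i : X ⟶ Z) (r : Z ⟶ X) (i' : Y ⟶ W) (r' : W ⟶ Y),
    i ≫ r = 𝟙 X ∧ i' ≫ r' = 𝟙 Y ∧ i ≫ g = f ≫ i' ∧ g ≫ r' = r ≫ f

/-- A model category structure (Quillen) on a category `C`: three classes of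
morphisms — weak equivalences, cofibrations and fibrations — satisfying
two-out-of-three, stability under retracts, the lifting axioms and the
factorization axioms. -/
structure ModelStructure (C : Type*) [Category C] where
  weq : MorphismProperty C
  cof : MorphismProperty C
  fib : MorphismProperty C
  weq_two_out_of_three : weq.HasTwoOutOfThreeProperty
  weq_retract : ∀ {X Y Z W : C} (f : X ⟶ Y) (g : Z ⟶ W),
    IsRetractOfHom f g → weq g → weq f
  cof_retract : ∀ {X Y Z W : C} (f : X ⟶ Y) (g : Z ⟶ W),
    IsRetractOfHom f g → cof g → cof f
  fib_retract : ∀ {X Y Z W : C} (f : X ⟶ Y) (g : Z ⟶ W),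
    IsRetractOfHom f g → fib g → fib f
  lift_cof_trivFib : ∀ {A B P Q : C} (i : A ⟶ B) (p : P ⟶ Q),
    cof i → fib p → weq p → HasLiftingProperty i p
  lift_trivCof_fib : ∀ {A B P Q : C} (i : A ⟶ B) (p : P ⟶ Q),
    cof i → weq i → fib p → HasLiftingProperty i p
  fact_cof_trivFib : ∀ {X Y : C} (f : X ⟶ Y),
    ∃ (Z : C) (i : X ⟶ Z) (p : Z ⟶ Y), cof i ∧ fib p ∧ weq p ∧ i ≫ p = f
  fact_trivCof_fib : ∀ {X Y : C} (f : X ⟶ Y),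
    ∃ (Z : C) (i : X ⟶ Z) (p : Z ⟶ Y), cof i ∧ weq i ∧ fib p ∧ i ≫ p = f

/-- The S-homotopy relation, as a relation on the morphisms of the full subcategory
of S-cofibrant flows. -/
def sHomotopyHomRel : HomRel (ObjectProperty.FullSubcategory SCofibrant) :=
  fun {_ _} f g => SHomotopy f.hom g.hom

/-- The canonical map `FLOW(X, lim Yⱼ) → lim FLOW(X, Yⱼ)`, the target being realized
as the subspace of the product `Π j, FLOW(X, Yⱼ)` consisting of the compatible
families. -/
def canonicalMapToLimit (X : Flow) {J : Type} [SmallCategory J] (D : J ⥤ Flow)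
    (c : Limits.Cone D) :
    FlowHom X c.pt →
      {p : ∀ j, FlowHom X (D.obj j) // ∀ ⦃j j' : J⦄ (φ : j ⟶ j'),
        (D.map φ).comp (p j) = p j'} :=
  fun g => ⟨fun j => (c.π.app j).comp g, by
    intro j j' φ
    have h := c.π.naturality φ
    have h2 : FlowHom.comp (D.map φ) (c.π.app j) = c.π.app j' := by
      have h3 := h.symm.trans
        (show ((Functor.const J).obj c.pt).map φ ≫ c.π.app j' = c.π.app j' from
          FlowHom.ext rfl rfl)
      exact h3
    show FlowHom.comp (D.map φ) (FlowHom.comp (c.π.app j) g) = FlowHom.comp (c.π.app j') g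
    rw [← FlowHom.comp_assoc, h2]⟩


section Helpers

open unitInterval

/-! ### Lifting properties -/

/-- Homotopy lifting property (Hurewicz fibration). -/
def HLP {E B : Type} [TopologicalSpace E] [TopologicalSpace B] (p : C(E, B)) : Prop :=
  ∀ (Z : Type) [TopologicalSpace Z] (H : C(Z × I, B)) (k : C(Z, E)),
    (∀ z, p (k z) = H (z, 0)) → ∃ K : C(Z × I, E), (∀ z, K (z, 0) = k z) ∧ ∀ y, p (K y) = H y

/-- Right lifting property against the inclusion of `S` in `Y`. -/
def Lifts {E B : Type} [TopologicalSpace E] [TopologicalSpace B] (p : C(E, B))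
    (Y : Type) [TopologicalSpace Y] (S : Set Y) : Prop :=
  ∀ (u : Y → E) (v : C(Y, B)), ContinuousOn u S → (∀ y ∈ S, p (u y) = v y) →
    ∃ w : C(Y, E), (∀ y ∈ S, w y = u y) ∧ ∀ y, p (w y) = v y

theorem lifts_of_retract {E B : Type} [TopologicalSpace E] [TopologicalSpace B] {p : C(E, B)}
    (hp : HLP p) {Y : Type} [TopologicalSpace Y] {S : Set Y} (φ : C(Y, I)) (D : C(Y × I, Y))
    (hφ : ∀ y ∈ S, φ y = 0) (hD : ∀ y, D (y, 0) ∈ S) (hD' : ∀ y, D (y, φ y) = y) :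
    Lifts p Y S := by
  intro u v hu huv
  obtain ⟨K, hK, hK'⟩ := hp Y (v.comp D)
    ⟨fun y => u (D (y, 0)), hu.comp_continuous (by fun_prop) hD⟩ (fun z => huv _ (hD z))
  refine ⟨⟨fun y => K (y, φ y), by fun_prop⟩, fun y hy => ?_, fun y => ?_⟩
  · have h1 := hD' y
    rw [hφ y hy] at h1
    simp only [ContinuousMap.coe_mk]
    rw [hφ y hy, hK]
    simp [h1]
  · simp [hK', hD']

theorem Lifts.homeo {E B : Type} [TopologicalSpace E] [TopologicalSpace B] {p : C(E, B)}
    {Y Y' : Type} [TopologicalSpace Y] [TopologicalSpace Y'] {S : Set Y} {S' : Set Y'}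
    (e : Y ≃ₜ Y') (he : ∀ y, y ∈ S ↔ e y ∈ S') (h : Lifts p Y' S') : Lifts p Y S := by
  intro u v hu huv
  have he' : ∀ y' ∈ S', e.symm y' ∈ S := fun y' hy' => by rw [he]; simpa using hy'
  obtain ⟨w, hw, hw'⟩ := h (u ∘ e.symm) (v.comp ⟨e.symm, e.symm.continuous⟩)
    (hu.comp e.symm.continuous.continuousOn he') (fun y hy => huv _ (he' y hy))
  refine ⟨w.comp ⟨e, e.continuous⟩, fun y hy => ?_, fun y => ?_⟩
  · simp [hw _ ((he y).1 hy)]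
  · simp [hw']

theorem ball_lifts {E B : Type} [TopologicalSpace E] [TopologicalSpace B] {p : C(E, B)}
    (hp : HLP p) (V : Type) [NormedAddCommGroup V] [NormedSpace ℝ V] :
    Lifts p (Metric.closedBall (0 : V) 1 × I) {y | y.2 = 0 ∨ ‖(y.1 : V)‖ = 1} := by
  let m : Metric.closedBall (0 : V) 1 × I → ℝ := fun y => max (2 * ‖(y.1 : V)‖) (2 - (y.2 : ℝ))
  have hb : ∀ y : Metric.closedBall (0 : V) 1 × I, ‖(y.1 : V)‖ ≤ 1 := fun y => by
    exact mem_closedBall_zero_iff.1 y.1.2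
  have h0 : ∀ y : Metric.closedBall (0 : V) 1 × I, 0 ≤ (y.2 : ℝ) := fun y => y.2.2.1
  have h1 : ∀ y : Metric.closedBall (0 : V) 1 × I, (y.2 : ℝ) ≤ 1 := fun y => y.2.2.2
  have hm1 : ∀ y, 1 ≤ m y := fun y => le_max_of_le_right (by linarith [h1 y])
  have hm2 : ∀ y, m y ≤ 2 := fun y => max_le (by linarith [hb y]) (by linarith [h0 y])
  have hmc : Continuous m := by fun_prop
  let l : Metric.closedBall (0 : V) 1 × I → ℝ := fun y => 2 / m y
  have hlc : Continuous l := continuous_const.div hmc (fun y => by linarith [hm1 y])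
  have hl1 : ∀ y, 1 ≤ l y := fun y => by
    rw [le_div_iff₀ (by linarith [hm1 y])]; linarith [hm2 y]
  have hl2 : ∀ y, l y ≤ 2 := fun y => by
    rw [div_le_iff₀ (by linarith [hm1 y])]; linarith [hm1 y]
  have hlm : ∀ y, l y * m y = 2 := fun y => div_mul_cancel₀ _ (by linarith [hm1 y])
  have hlx : ∀ y, l y * ‖(y.1 : V)‖ ≤ 1 := fun y => by
    nlinarith [hlm y, hl1 y, le_max_left (2 * ‖(y.1 : V)‖) (2 - (y.2 : ℝ))]
  have hls : ∀ y, l y * (2 - (y.2 : ℝ)) ≤ 2 := fun y => by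
    nlinarith [hlm y, hl1 y, le_max_right (2 * ‖(y.1 : V)‖) (2 - (y.2 : ℝ))]
  let μ : (Metric.closedBall (0 : V) 1 × I) × I → ℝ := fun z => max 1 (l z.1 - z.2)
  have hμc : Continuous μ := by fun_prop
  have hμ1 : ∀ z, 1 ≤ μ z := fun z => le_max_left _ _
  have hμl : ∀ z, μ z ≤ l z.1 := fun z => max_le (hl1 _) (by linarith [z.2.2.1])
  let D : C((Metric.closedBall (0 : V) 1 × I) × I, Metric.closedBall (0 : V) 1 × I) :=
    ⟨fun z => (⟨μ z • (z.1.1 : V), by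
        rw [mem_closedBall_zero_iff, norm_smul, Real.norm_eq_abs,
          abs_of_nonneg (by linarith [hμ1 z])]
        exact (mul_le_mul_of_nonneg_right (hμl z) (norm_nonneg _)).trans (hlx _)⟩,
      ⟨2 - μ z * (2 - (z.1.2 : ℝ)), by
        have := mul_le_mul_of_nonneg_right (hμl z) (show 0 ≤ 2 - (z.1.2 : ℝ) by linarith [h1 z.1])
        linarith [hls z.1], by nlinarith [hμ1 z, h1 z.1]⟩), by fun_prop⟩
  let φ : C(Metric.closedBall (0 : V) 1 × I, I) :=
    ⟨fun y => ⟨l y - 1, by linarith [hl1 y], by linarith [hl2 y]⟩, by fun_prop⟩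
  refine lifts_of_retract hp φ D ?_ ?_ ?_
  · intro y hy
    have hmy : m y = 2 := by
      apply le_antisymm (hm2 y)
      rcases hy with hy | hy
      · refine le_max_of_le_right ?_
        simp [hy]
      · refine le_max_of_le_left ?_
        rw [hy]; norm_num
    apply Subtype.ext
    simp [φ, l, hmy]
  · intro y
    have hμ : μ (y, 0) = l y := by simp [μ, hl1]
    simp only [Set.mem_ofPred_eq]
    rcases le_total (2 * ‖(y.1 : V)‖) (2 - (y.2 : ℝ)) with h | h
    · left
      apply Subtype.ext
      have : m y = 2 - (y.2 : ℝ) := max_eq_right h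
      have h2 := hlm y
      rw [this] at h2
      simp only [D, ContinuousMap.coe_mk, hμ, h2]
      simp
    · right
      have : m y = 2 * ‖(y.1 : V)‖ := max_eq_left h
      have h2 := hlm y
      rw [this] at h2
      simp only [D, ContinuousMap.coe_mk, hμ, norm_smul, Real.norm_eq_abs,
          abs_of_nonneg (show 0 ≤ l y by linarith [hl1 y])]
      linarith
  · intro y
    have hμ : μ (y, φ y) = 1 := by simp [μ, φ]
    refine Prod.ext (Subtype.ext ?_) (Subtype.ext ?_)
    · simp [D, hμ]
    · simp [D, hμ]

/-- The pair `(Y, S)` has the relative homotopy lifting property. -/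
def Good (Y : Type) [TopologicalSpace Y] (S : Set Y) : Prop :=
  ∀ ⦃E B : Type⦄ [TopologicalSpace E] [TopologicalSpace B] ⦃p : C(E, B)⦄, HLP p →
    Lifts p (Y × I) {y | y.2 = 0 ∨ y.1 ∈ S}

theorem Good.homeo {Y Y' : Type} [TopologicalSpace Y] [TopologicalSpace Y'] {S : Set Y}
    {S' : Set Y'} (h : Good Y' S') (e : Y ≃ₜ Y') (he : ∀ y, y ∈ S ↔ e y ∈ S') : Good Y S := by
  intro E B _ _ p hp
  refine (h hp).homeo (e.prodCongr (Homeomorph.refl I)) ?_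
  rintro ⟨y, t⟩
  simp [he]

theorem good_ball (V : Type) [NormedAddCommGroup V] [NormedSpace ℝ V] :
    Good (Metric.closedBall (0 : V) 1) {y | ‖(y : V)‖ = 1} :=
  fun _ _ _ _ _ hp => ball_lifts hp V

theorem abs_two_mul_sub_one_le (t : I) : |2 * (t : ℝ) - 1| ≤ 1 := by
  rw [abs_le]; constructor <;> linarith [t.2.1, t.2.2]

theorem abs_two_mul_sub_one_eq (t : I) : |2 * (t : ℝ) - 1| = 1 ↔ t = 0 ∨ t = 1 := by
  rw [abs_eq zero_le_one, Subtype.ext_iff, Subtype.ext_iff]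
  simp only [Set.Icc.coe_zero, Set.Icc.coe_one]
  constructor
  · rintro (h | h)
    · right; linarith
    · left; linarith
  · rintro (h | h)
    · right; linarith
    · left; linarith

theorem half_mem {x : ℝ} (h : |x| ≤ 1) : (x + 1) / 2 ∈ I := by
  rw [abs_le] at h; constructor <;> linarith [h.1, h.2]

/-- The cube as a sup-norm ball. -/
noncomputable def cubeBall (n : ℕ) : (Fin n → I) ≃ₜ Metric.closedBall (0 : Fin n → ℝ) 1 where
  toFun y := ⟨fun i => 2 * (y i : ℝ) - 1, by
    rw [mem_closedBall_zero_iff, pi_norm_le_iff_of_nonneg zero_le_one]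
    exact fun i => abs_two_mul_sub_one_le _⟩
  invFun x := fun i => ⟨(x.1 i + 1) / 2, half_mem ((norm_le_pi_norm x.1 i).trans (mem_closedBall_zero_iff.1 x.2))⟩
  left_inv y := by
    funext i; apply Subtype.ext; simp
  right_inv x := by
    apply Subtype.ext; funext i; simp; ring
  continuous_toFun := by fun_prop
  continuous_invFun := by
    refine continuous_pi fun i => Continuous.subtype_mk ?_ _
    exact ((((continuous_apply i).comp continuous_subtype_val).add continuous_const).div_const 2)

theorem cubeBall_norm {n : ℕ} (y : Fin n → I) :
    y ∈ Cube.boundary (Fin n) ↔ ‖(cubeBall n y : Fin n → ℝ)‖ = 1 := by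
  have hle : ∀ i, ‖(cubeBall n y : Fin n → ℝ) i‖ ≤ 1 := fun i => abs_two_mul_sub_one_le _
  have key : ∀ i, ‖(cubeBall n y : Fin n → ℝ) i‖ = 1 ↔ y i = 0 ∨ y i = 1 :=
    fun i => abs_two_mul_sub_one_eq _
  constructor
  · rintro ⟨i, hi⟩
    refine le_antisymm ((pi_norm_le_iff_of_nonneg zero_le_one).2 hle) ?_
    exact ((key i).2 hi).symm.le.trans (norm_le_pi_norm _ i)
  · intro h
    by_contra hc
    have : ‖(cubeBall n y : Fin n → ℝ)‖ < 1 := by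
      rw [pi_norm_lt_iff zero_lt_one]
      intro i
      refine lt_of_le_of_ne (hle i) (fun h' => hc ⟨i, (key i).1 h'⟩)
    linarith

/-- Boundary of `I^n × I`. -/
def bd (n : ℕ) : Set ((Fin n → I) × I) := {y | y.1 ∈ Cube.boundary (Fin n) ∨ y.2 = 0 ∨ y.2 = 1}

noncomputable def cubeBall' (n : ℕ) :
    ((Fin n → I) × I) ≃ₜ Metric.closedBall (0 : (Fin n → ℝ) × ℝ) 1 where
  toFun y := ⟨((cubeBall n y.1 : Fin n → ℝ), 2 * (y.2 : ℝ) - 1), by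
    rw [mem_closedBall_zero_iff, Prod.norm_def]
    exact max_le (mem_closedBall_zero_iff.1 (cubeBall n y.1).2) (abs_two_mul_sub_one_le _)⟩
  invFun x := ((cubeBall n).symm ⟨x.1.1, by
      have := x.2
      rw [mem_closedBall_zero_iff] at this ⊢
      exact (norm_fst_le _).trans this⟩, ⟨(x.1.2 + 1) / 2, half_mem (by
      have := x.2
      rw [mem_closedBall_zero_iff] at this
      exact (norm_snd_le _).trans this)⟩)
  left_inv y := by
    refine Prod.ext ?_ (Subtype.ext ?_) <;> simp
  right_inv x := by
    apply Subtype.ext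
    refine Prod.ext ?_ ?_
    · simp
    · simp; ring
  continuous_toFun := by fun_prop
  continuous_invFun := by fun_prop

theorem cubeBall'_norm {n : ℕ} (y : (Fin n → I) × I) :
    y ∈ bd n ↔ ‖(cubeBall' n y : (Fin n → ℝ) × ℝ)‖ = 1 := by
  have h1 : ‖(cubeBall n y.1 : Fin n → ℝ)‖ ≤ 1 := mem_closedBall_zero_iff.1 (cubeBall n y.1).2
  have h2 := abs_two_mul_sub_one_le y.2
  have h3 : ‖(cubeBall' n y : (Fin n → ℝ) × ℝ)‖ =
    max ‖(cubeBall n y.1 : Fin n → ℝ)‖ |2 * (y.2 : ℝ) - 1| := rfl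
  rw [h3, bd, Set.mem_ofPred_eq, cubeBall_norm, ← abs_two_mul_sub_one_eq]
  constructor
  · rintro (h | h)
    · rw [h]; exact max_eq_left h2
    · rw [h]; exact max_eq_right h1
  · intro h
    rcases max_choice ‖(cubeBall n y.1 : Fin n → ℝ)‖ |2 * (y.2 : ℝ) - 1| with h' | h'
    · left; rw [← h', h]
    · right; rw [← h', h]

theorem good_cube (n : ℕ) : Good (Fin n → I) (Cube.boundary (Fin n)) :=
  (good_ball (Fin n → ℝ)).homeo (cubeBall n) cubeBall_norm

theorem good_cube' (n : ℕ) : Good ((Fin n → I) × I) (bd n) :=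
  (good_ball ((Fin n → ℝ) × ℝ)).homeo (cubeBall' n) cubeBall'_norm

/-- The closed disk as a cube. -/
theorem exists_disk_homeo (m : ℕ) :
    ∃ e : Metric.closedBall (0 : EuclideanSpace ℝ (Fin (m + 1))) 1 ≃ₜ ((Fin m → I) × I),
      ∀ y : Metric.closedBall (0 : EuclideanSpace ℝ (Fin (m + 1))) 1,
        (y : EuclideanSpace ℝ (Fin (m + 1))) ∈
          Metric.sphere (0 : EuclideanSpace ℝ (Fin (m + 1))) 1 ↔ e y ∈ bd m := by
  have L : EuclideanSpace ℝ (Fin (m + 1)) ≃L[ℝ] (Fin m → ℝ) × ℝ :=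
    ContinuousLinearEquiv.ofFinrankEq (by simp)
  let b : Set (EuclideanSpace ℝ (Fin (m + 1))) := L ⁻¹' Metric.closedBall 0 1
  have hbc : Convex ℝ b := (convex_closedBall 0 1).is_linear_preimage L.toLinearMap.isLinear
  have hbcl : IsClosed b := Metric.isClosed_closedBall.preimage L.continuous
  have hinterior : interior b = L ⁻¹' Metric.ball 0 1 := by
    rw [← interior_closedBall (0 : (Fin m → ℝ) × ℝ) one_ne_zero]
    exact (L.toHomeomorph.preimage_interior _).symm
  have hfr : frontier b = L ⁻¹' Metric.sphere 0 1 := by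
    rw [← frontier_closedBall (0 : (Fin m → ℝ) × ℝ) one_ne_zero]
    exact (L.toHomeomorph.preimage_frontier _).symm
  have hbne : (interior b).Nonempty := ⟨0, by rw [hinterior]; simp⟩
  have hbb : Bornology.IsBounded b := by
    have : b = L.symm '' Metric.closedBall 0 1 :=
      (L.toEquiv.symm.image_eq_preimage_symm (Metric.closedBall 0 1)).symm
    rw [this]
    exact ((isCompact_closedBall _ _).image L.symm.continuous).isBounded
  obtain ⟨e, he1, he2, he3⟩ :=
    exists_homeomorph_image_interior_closure_frontier_eq_unitBall hbc hbne hbb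
  rw [hbcl.closure_eq] at he2
  let f := e.symm.trans L.toHomeomorph
  have hf : ∀ x, x ∈ Metric.closedBall (0 : EuclideanSpace ℝ (Fin (m + 1))) 1 ↔
      f x ∈ Metric.closedBall (0 : (Fin m → ℝ) × ℝ) 1 := by
    intro x
    rw [← he2, ← e.preimage_symm]; rfl
  have hf' : ∀ x, x ∈ Metric.sphere (0 : EuclideanSpace ℝ (Fin (m + 1))) 1 ↔
      f x ∈ Metric.sphere (0 : (Fin m → ℝ) × ℝ) 1 := by
    intro x
    rw [← he3, ← e.preimage_symm, hfr]; rfl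
  refine ⟨(f.subtype hf).trans (cubeBall' m).symm, fun y => ?_⟩
  rw [cubeBall'_norm, hf' y]
  simp

/-! ### Homotopy groups -/

theorem glue {Y E : Type} [TopologicalSpace Y] [TopologicalSpace E] {S T : Set Y}
    (hS : IsClosed S) (hT : IsClosed T) {a b : Y → E} (ha : ContinuousOn a S)
    (hb : ContinuousOn b T) (hab : ∀ y ∈ S, y ∈ T → a y = b y) :
    ∃ u : Y → E, ContinuousOn u (S ∪ T) ∧ (∀ y ∈ S, u y = a y) ∧ (∀ y ∈ T, u y = b y) := by
  classical
  have h1 : ∀ y ∈ S, S.piecewise a b y = a y := fun y hy => Set.piecewise_eq_of_mem _ _ _ hy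
  have h2 : ∀ y ∈ T, S.piecewise a b y = b y := fun y hy => by
    by_cases h : y ∈ S
    · rw [h1 y h, hab y h hy]
    · exact Set.piecewise_eq_of_notMem _ _ _ h
  exact ⟨S.piecewise a b, (ha.congr h1).union_of_isClosed (hb.congr h2) hS hT, h1, h2⟩

theorem isClosed_boundary (n : ℕ) : IsClosed (Cube.boundary (Fin n)) := by
  have : Cube.boundary (Fin n) = ⋃ i : Fin n, ({y | y i = 0} ∪ {y | y i = 1}) := by
    ext y; simp [Cube.boundary]
  rw [this]
  refine isClosed_iUnion_of_finite fun i => ?_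
  exact (isClosed_eq (continuous_apply i) continuous_const).union
    (isClosed_eq (continuous_apply i) continuous_const)

theorem hlp_punit {E : Type} [TopologicalSpace E] : HLP (⟨fun _ => PUnit.unit, continuous_const⟩ : C(E, PUnit)) := by
  intro Z _ H k hk
  exact ⟨⟨fun z => k z.1, by fun_prop⟩, fun z => rfl, fun y => rfl⟩

/-- Homotopy extension. -/
theorem Good.ext {Y : Type} [TopologicalSpace Y] {S : Set Y} (h : Good Y S)
    {A : Type} [TopologicalSpace A] (u : Y × I → A)
    (hu : ContinuousOn u {y | y.2 = 0 ∨ y.1 ∈ S}) :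
    ∃ w : C(Y × I, A), ∀ y : Y × I, (y.2 = 0 ∨ y.1 ∈ S) → w y = u y := by
  obtain ⟨w, hw, -⟩ := h hlp_punit u ⟨fun _ => PUnit.unit, continuous_const⟩ hu (fun _ _ => rfl)
  exact ⟨w, hw⟩

theorem Good.ext2 {Y : Type} [TopologicalSpace Y] {S : Set Y} (h : Good Y S) (hS : IsClosed S)
    {A : Type} [TopologicalSpace A] (a : C(Y, A)) (b : C(Y × I, A))
    (hab : ∀ y ∈ S, a y = b (y, 0)) :
    ∃ w : C(Y × I, A), (∀ y, w (y, 0) = a y) ∧ ∀ y ∈ S, ∀ t, w (y, t) = b (y, t) := by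
  obtain ⟨u, hu, hu1, hu2⟩ := glue (S := {y : Y × I | y.2 = 0}) (T := {y | y.1 ∈ S})
    (isClosed_eq continuous_snd continuous_const) (hS.preimage continuous_fst)
    (a := fun y => a y.1) (b := b) (by fun_prop) (by fun_prop)
    (by rintro ⟨y, t⟩ (rfl : t = 0) h; exact hab y h)
  obtain ⟨w, hw⟩ := h.ext u hu
  refine ⟨w, fun y => ?_, fun y hy t => ?_⟩
  · rw [hw _ (Or.inl rfl), hu1 _ rfl]
  · rw [hw _ (Or.inr hy), hu2 _ hy]

theorem cube_ext {n : ℕ} {A : Type} [TopologicalSpace A]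
    (c a0 a1 : C((Fin n → I) × I, A)) (z : C(I, A))
    (h0 : ∀ y, c (y, 0) = a0 (y, 0)) (h1 : ∀ y, c (y, 1) = a1 (y, 0))
    (hz : ∀ y ∈ Cube.boundary (Fin n), ∀ t, c (y, t) = z 0)
    (h0z : ∀ y ∈ Cube.boundary (Fin n), ∀ s, a0 (y, s) = z s)
    (h1z : ∀ y ∈ Cube.boundary (Fin n), ∀ s, a1 (y, s) = z s) :
    ∃ w : C(((Fin n → I) × I) × I, A), (∀ y t, w ((y, t), 0) = c (y, t)) ∧
      (∀ y s, w ((y, 0), s) = a0 (y, s)) ∧ (∀ y s, w ((y, 1), s) = a1 (y, s)) ∧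
      (∀ y ∈ Cube.boundary (Fin n), ∀ t s, w ((y, t), s) = z s) := by
  have hB := isClosed_boundary n
  have c1 : IsClosed {y : ((Fin n → I) × I) × I | y.2 = 0} :=
    isClosed_eq continuous_snd continuous_const
  have c2 : IsClosed {y : ((Fin n → I) × I) × I | y.1.2 = 0} :=
    isClosed_eq (by fun_prop) continuous_const
  have c3 : IsClosed {y : ((Fin n → I) × I) × I | y.1.2 = 1} :=
    isClosed_eq (by fun_prop) continuous_const
  have c4 : IsClosed {y : ((Fin n → I) × I) × I | y.1.1 ∈ Cube.boundary (Fin n)} :=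
    hB.preimage (by fun_prop)
  obtain ⟨u, hu, hu1, hu2⟩ := glue c1 c2 (a := fun y => c y.1) (b := fun y => a0 (y.1.1, y.2))
    (by fun_prop) (by fun_prop) (by
      rintro ⟨⟨y, t⟩, s⟩ (rfl : s = 0) (rfl : t = 0); exact h0 y)
  obtain ⟨u', hu', hu'1, hu'2⟩ := glue (c1.union c2) c3 (b := fun y => a1 (y.1.1, y.2))
    hu (by fun_prop) (by
      rintro ⟨⟨y, t⟩, s⟩ (h | h) (rfl : t = 1)
      · rw [hu1 _ h]; obtain rfl : s = 0 := h; exact h1 y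
      · exact absurd h (by simp))
  obtain ⟨u'', hu'', hu''1, hu''2⟩ := glue ((c1.union c2).union c3) c4 (b := fun y => z y.2)
    hu' (by fun_prop) (by
      rintro ⟨⟨y, t⟩, s⟩ ((h | h) | h) hy
      · rw [hu'1 _ (Or.inl h), hu1 _ h]; obtain rfl : s = 0 := h; exact hz y hy t
      · rw [hu'1 _ (Or.inr h), hu2 _ h]; exact h0z y hy s
      · rw [hu'2 _ h]; exact h1z y hy s)
  obtain ⟨w, hw⟩ := (good_cube' n).ext u'' (hu''.mono (by
    rintro ⟨⟨y, t⟩, s⟩ (h | (h | (h | h)))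
    · exact Or.inl (Or.inl (Or.inl h))
    · exact Or.inr h
    · exact Or.inl (Or.inl (Or.inr h))
    · exact Or.inl (Or.inr h)))
  refine ⟨w, fun y t => ?_, fun y s => ?_, fun y s => ?_, fun y hy t s => ?_⟩
  · rw [hw _ (Or.inl rfl), hu''1 _ (Or.inl (Or.inl rfl)), hu'1 _ (Or.inl rfl), hu1 _ rfl]
  · rw [hw _ (Or.inr (Or.inr (Or.inl rfl))), hu''1 _ (Or.inl (Or.inr rfl)), hu'1 _ (Or.inr rfl),
      hu2 _ rfl]
  · rw [hw _ (Or.inr (Or.inr (Or.inr rfl))), hu''1 _ (Or.inr rfl), hu'2 _ rfl]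
  · rw [hw _ (Or.inr (Or.inl hy)), hu''2 _ hy]

/-- Constructor for `GenLoop.Homotopic`. -/
theorem genLoop_homotopic {n : ℕ} {A : Type} [TopologicalSpace A] {x : A}
    {f g : GenLoop (Fin n) A x} (w : C((Fin n → I) × I, A)) (h0 : ∀ y, w (y, 0) = f y)
    (h1 : ∀ y, w (y, 1) = g y) (hb : ∀ y ∈ Cube.boundary (Fin n), ∀ t, w (y, t) = x) :
    GenLoop.Homotopic f g :=
  ⟨{ toFun := fun p => w (p.2, p.1)
     continuous_toFun := by fun_prop
     map_zero_left := h0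
     map_one_left := h1
     prop' := fun t y hy => by
      show w (y, t) = f y
      exact (hb y hy t).trans (f.2 y hy).symm }⟩

/-- Destructor for `GenLoop.Homotopic`. -/
theorem exists_of_genLoop_homotopic {n : ℕ} {A : Type} [TopologicalSpace A] {x : A}
    {f g : GenLoop (Fin n) A x} (h : GenLoop.Homotopic f g) :
    ∃ w : C((Fin n → I) × I, A), (∀ y, w (y, 0) = f y) ∧ (∀ y, w (y, 1) = g y) ∧
      ∀ y ∈ Cube.boundary (Fin n), ∀ t, w (y, t) = x := by
  obtain ⟨H⟩ := h
  refine ⟨⟨fun p => H (p.2, p.1), by fun_prop⟩, fun y => H.map_zero_left y,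
    fun y => H.map_one_left y, fun y hy t => ?_⟩
  show H (t, y) = x
  rw [H.eq_fst t hy]
  exact f.2 y hy

theorem piMap_comp {A B C : Type} [TopologicalSpace A] [TopologicalSpace B] [TopologicalSpace C]
    (g : C(B, C)) (f : C(A, B)) (n : ℕ) (x : A) :
    piMap (g.comp f) (Fin n) x = piMap g (Fin n) (f x) ∘ piMap f (Fin n) x := by
  funext q
  induction q using Quotient.inductionOn
  rfl

theorem pi0Map_comp {A B C : Type} [TopologicalSpace A] [TopologicalSpace B] [TopologicalSpace C]
    (g : C(B, C)) (f : C(A, B)) : pi0Map (g.comp f) = pi0Map g ∘ pi0Map f := by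
  funext q
  induction q using Quotient.inductionOn
  rfl

theorem weak_of_homotopic_id {A : Type} [TopologicalSpace A] {k : C(A, A)}
    (h : ContinuousMap.Homotopic (ContinuousMap.id A) k) : IsWeakHomotopyEquiv k := by
  obtain ⟨K⟩ := h
  have K0 : ∀ x, K (0, x) = x := fun x => K.map_zero_left x
  have K1 : ∀ x, K (1, x) = k x := fun x => K.map_one_left x
  refine ⟨?_, fun x n => ⟨?_, ?_⟩⟩
  · have : pi0Map k = id := by
      funext q
      induction q using Quotient.inductionOn with | _ a => ?_
      refine Quotient.sound ?_
      refine Joined.symm ⟨⟨⟨fun t => K (t, a), by fun_prop⟩, K0 a, K1 a⟩⟩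
    rw [this]; exact Function.bijective_id
  · intro q1 q2
    induction q1 using Quotient.inductionOn with | _ g1 => ?_
    induction q2 using Quotient.inductionOn with | _ g2 => ?_
    intro hq
    obtain ⟨M, hM0, hM1, hMb⟩ := exists_of_genLoop_homotopic (Quotient.exact hq)
    have e1 : ∀ y, M (y, 0) = k (g1 y) := hM0
    have e2 : ∀ y, M (y, 1) = k (g2 y) := hM1
    have b1 : ∀ y ∈ Cube.boundary (Fin n), g1 y = x := g1.2
    have b2 : ∀ y ∈ Cube.boundary (Fin n), g2 y = x := g2.2
    have c1 : Continuous g1 := g1.1.continuous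
    have c2 : Continuous g2 := g2.1.continuous
    obtain ⟨w, -, w0, w1, wb⟩ := cube_ext M
      ⟨fun p => K (σ p.2, g1 p.1), by fun_prop⟩ ⟨fun p => K (σ p.2, g2 p.1), by fun_prop⟩
      ⟨fun s => K (σ s, x), by fun_prop⟩
      (by simp [K1, e1]) (by simp [K1, e2]) (by
        intro y hy t; simp [hMb y hy t, K1])
      (by intro y hy s; simp [b1 y hy]) (by intro y hy s; simp [b2 y hy])
    refine Quotient.sound (genLoop_homotopic ⟨fun p => w (p, 1), by fun_prop⟩ ?_ ?_ ?_)
    · intro y; simp [w0, K0]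
    · intro y; simp [w1, K0]
    · intro y hy t; simp [wb y hy, K0]
  · intro q
    induction q using Quotient.inductionOn with | _ g => ?_
    have b : ∀ y ∈ Cube.boundary (Fin n), g y = k x := g.2
    have c : Continuous g := g.1.continuous
    obtain ⟨L, L0, Lb⟩ := (good_cube n).ext2 (isClosed_boundary n) g.1
      ⟨fun p => K (σ p.2, x), by fun_prop⟩ (by intro y hy; simpa [K1] using b y hy)
    let g' : GenLoop (Fin n) A x := ⟨⟨fun y => L (y, 1), by fun_prop⟩, by
      intro y hy; simp [Lb y hy, K0]⟩
    have c' : Continuous g' := g'.1.continuous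
    have b' : ∀ y ∈ Cube.boundary (Fin n), g' y = x := g'.2
    refine ⟨Quotient.mk _ g', ?_⟩
    obtain ⟨w, -, w0, w1, wb⟩ := cube_ext (n := n) ⟨fun p => g' p.1, by fun_prop⟩
      ⟨fun p => K (p.2, g' p.1), by fun_prop⟩ ⟨fun p => L (p.1, σ p.2), by fun_prop⟩
      ⟨fun s => K (s, x), by fun_prop⟩ (by simp [K0]) (by intro y; simp; rfl) (by
        intro y hy t; simp [b' y hy, K0])
      (by intro y hy s; simp [b' y hy]) (by intro y hy s; simp [Lb y hy])
    refine Quotient.sound (genLoop_homotopic ⟨fun p => w (p, 1), by fun_prop⟩ ?_ ?_ ?_)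
    · intro y; simp [w0, K1]; rfl
    · intro y
      have := L0 y
      simp [w1]; exact this
    · intro y hy t; simp [wb y hy, K1]

theorem bij_of_comp_left {α β γ : Type*} {g : β → γ} {f : α → β} (hg : Function.Bijective g)
    (h : Function.Bijective (g ∘ f)) : Function.Bijective f :=
  (Function.Bijective.of_comp_iff' hg f).1 h

theorem weak_of_comp_left {A B C : Type} [TopologicalSpace A] [TopologicalSpace B]
    [TopologicalSpace C] {g : C(B, C)} {f : C(A, B)} (hg : IsWeakHomotopyEquiv g)
    (h : IsWeakHomotopyEquiv (g.comp f)) : IsWeakHomotopyEquiv f := by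
  refine ⟨bij_of_comp_left hg.1 (by rw [← pi0Map_comp]; exact h.1), fun x n =>
    bij_of_comp_left (hg.2 (f x) n) (by rw [← piMap_comp]; exact h.2 x n)⟩

theorem weak_of_homotopy_equiv {A B : Type} [TopologicalSpace A] [TopologicalSpace B]
    (f : C(A, B)) (g : C(B, A)) (hgf : ContinuousMap.Homotopic (ContinuousMap.id A) (g.comp f))
    (hfg : ContinuousMap.Homotopic (ContinuousMap.id B) (f.comp g)) : IsWeakHomotopyEquiv f := by
  have h1 := weak_of_homotopic_id hgf
  have h2 := weak_of_homotopic_id hfg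
  refine ⟨⟨?_, ?_⟩, fun x n => ?_⟩
  · have := h1.1.1
    rw [pi0Map_comp] at this
    exact this.of_comp
  · have := h2.1.2
    rw [pi0Map_comp] at this
    exact this.of_comp
  · have k1 := h1.2 x n
    have k2 := h2.2 (f x) n
    rw [piMap_comp] at k1 k2
    exact bij_of_comp_left ⟨k2.1.of_comp, k1.2.of_comp⟩ k1

/-! ### Trivial fibrations lift against boundaries of cubes -/

section Core

variable {E B : Type} [TopologicalSpace E] [TopologicalSpace B] {p : C(E, B)} {m : ℕ}

theorem isClosed_bd (m : ℕ) : IsClosed (bd m) :=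
  ((isClosed_boundary m).preimage continuous_fst).union
    ((isClosed_eq continuous_snd continuous_const).union
      (isClosed_eq continuous_snd continuous_const))

theorem solve_of_homotopy (hp : HLP p) (U : ((Fin m → I) × I) × I → E)
    (hU : ContinuousOn U {y | y.1 ∈ bd m}) (V : C(((Fin m → I) × I) × I, B))
    (hUV : ∀ y ∈ bd m, ∀ s, p (U (y, s)) = V (y, s)) (w : C((Fin m → I) × I, E))
    (hw : ∀ y ∈ bd m, w y = U (y, 0)) (hpw : ∀ y, p (w y) = V (y, 0)) :
    ∃ w' : C((Fin m → I) × I, E), (∀ y ∈ bd m, w' y = U (y, 1)) ∧ ∀ y, p (w' y) = V (y, 1) := by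
  obtain ⟨u, hu, hu1, hu2⟩ := glue (S := {y : ((Fin m → I) × I) × I | y.2 = 0})
    (T := {y | y.1 ∈ bd m})
    (isClosed_eq continuous_snd continuous_const) ((isClosed_bd m).preimage continuous_fst)
    (a := fun y => w y.1) (b := U) (by fun_prop) hU
    (by rintro ⟨y, t⟩ (rfl : t = 0) h; exact hw y h)
  obtain ⟨W, hW, hW'⟩ := good_cube' m hp u V hu (by
    rintro ⟨y, t⟩ (h | h)
    · rw [hu1 _ h]; obtain rfl : t = 0 := h; exact hpw y
    · rw [hu2 _ h]; exact hUV y h t)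
  refine ⟨⟨fun y => W (y, 1), by fun_prop⟩, fun y hy => ?_, fun y => hW' _⟩
  exact (hW _ (Or.inr hy)).trans (hu2 _ hy)

/-- `g` extends (relatively to `w`) to a map which agrees with `w` off the top face. -/
def Solv (p : C(E, B)) (w : C((Fin m → I) × I, E)) (g : C((Fin m → I), E)) : Prop :=
  ∃ w' : C((Fin m → I) × I, E), (∀ y ∈ Cube.boundary (Fin m), ∀ t, w' (y, t) = w (y, t)) ∧
    (∀ y, w' (y, 0) = w (y, 0)) ∧ (∀ y, w' (y, 1) = g y) ∧ ∀ y, p (w' y) = p (w y)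

theorem solv_move (hp : HLP p) (W : C(((Fin m → I) × I) × I, E)) (w w1 : C((Fin m → I) × I, E))
    (hw : ∀ y, W (y, 0) = w y) (hw1 : ∀ y, W (y, 1) = w1 y)
    (g : C((Fin m → I), E)) (hg : ∀ y ∈ Cube.boundary (Fin m), g y = w (y, 1))
    (hpg : ∀ y, p (g y) = p (w (y, 1))) :
    ∃ g' : C((Fin m → I), E), (∀ y ∈ Cube.boundary (Fin m), g' y = w1 (y, 1)) ∧
      (∀ y, p (g' y) = p (w1 (y, 1))) ∧ (Solv p w1 g' → Solv p w g) := by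
  obtain ⟨u, hu, hu1, hu2⟩ := glue (S := {y : (Fin m → I) × I | y.2 = 0})
    (T := {y | y.1 ∈ Cube.boundary (Fin m)})
    (isClosed_eq continuous_snd continuous_const) ((isClosed_boundary m).preimage continuous_fst)
    (a := fun y => g y.1) (b := fun y => W ((y.1, 1), y.2)) (by fun_prop) (by fun_prop)
    (by rintro ⟨y, t⟩ (rfl : t = 0) h; simp [hg y h, hw])
  obtain ⟨G, hG, hG'⟩ := good_cube m hp u ⟨fun y => p (W ((y.1, 1), y.2)), by fun_prop⟩ hu (by
    rintro ⟨y, t⟩ (h | h)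
    · rw [hu1 _ h]; obtain rfl : t = 0 := h; simp [hpg, hw]
    · rw [hu2 _ h]; rfl)
  have G0 : ∀ y, G (y, 0) = g y := fun y => (hG _ (Or.inl rfl)).trans (hu1 _ rfl)
  have Gb : ∀ y ∈ Cube.boundary (Fin m), ∀ s, G (y, s) = W ((y, 1), s) := fun y hy s =>
    (hG _ (Or.inr hy)).trans (hu2 _ hy)
  have Gp : ∀ y s, p (G (y, s)) = p (W ((y, 1), s)) := fun y s => hG' _
  refine ⟨⟨fun y => G (y, 1), by fun_prop⟩, fun y hy => by simp [Gb y hy, hw1],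
    fun y => by simp [Gp, hw1], ?_⟩
  rintro ⟨w', h1, h2, h3, h4⟩
  have h3' : ∀ y, w' (y, 1) = G (y, 1) := h3
  obtain ⟨U, hU, hU1, hU2⟩ := glue
    (S := {y : ((Fin m → I) × I) × I | y.1.1 ∈ Cube.boundary (Fin m) ∨ y.1.2 = 0})
    (T := {y | y.1.2 = 1})
    (((isClosed_boundary m).preimage (by fun_prop)).union
      (isClosed_eq (by fun_prop) continuous_const)) (isClosed_eq (by fun_prop) continuous_const)
    (a := fun y => W (y.1, σ y.2)) (b := fun y => G (y.1.1, σ y.2)) (by fun_prop) (by fun_prop)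
    (by
      rintro ⟨⟨y, t⟩, s⟩ (h | h) (rfl : t = 1)
      · exact (Gb y h _).symm
      · exact absurd h (by simp))
  obtain ⟨w'', k1, k2⟩ := solve_of_homotopy hp U (hU.mono (by
      rintro ⟨⟨y, t⟩, s⟩ (h | (h | h))
      · exact Or.inl (Or.inl h)
      · exact Or.inl (Or.inr h)
      · exact Or.inr h)) ⟨fun y => p (W (y.1, σ y.2)), by fun_prop⟩ (by
      rintro ⟨y, t⟩ (h | (h | h)) s
      · rw [hU1 _ (Or.inl h)]; rfl
      · rw [hU1 _ (Or.inr h)]; rfl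
      · rw [hU2 _ h]; obtain rfl : t = 1 := h; exact Gp _ _) w' (by
      rintro ⟨y, t⟩ (h | (h | h))
      · rw [hU1 _ (Or.inl h), h1 y h]; simp [hw1]
      · rw [hU1 _ (Or.inr h)]; obtain rfl : t = 0 := h; simp [hw1, h2]
      · rw [hU2 _ h]; obtain rfl : t = 1 := h; simp [h3']) (by
      intro y; simp [hw1, h4])
  refine ⟨w'', fun y hy t => ?_, fun y => ?_, fun y => ?_, fun y => ?_⟩
  · rw [k1 _ (Or.inl hy), hU1 _ (Or.inl hy)]; simp [hw]
  · rw [k1 _ (Or.inr (Or.inl rfl)), hU1 _ (Or.inr rfl)]; simp [hw]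
  · rw [k1 _ (Or.inr (Or.inr rfl)), hU2 _ rfl]; simp [G0]
  · simp [k2, hw]

/-- `I^(m+1)` as `I^m × I`. -/
def snocHomeo (m : ℕ) : (Fin (m + 1) → I) ≃ₜ (Fin m → I) × I where
  toFun y := (fun i => y i.castSucc, y (Fin.last m))
  invFun z := Fin.snoc (α := fun _ => I) z.1 z.2
  left_inv y := by
    funext i
    refine Fin.lastCases ?_ (fun i => ?_) i <;> simp
  right_inv z := by simp
  continuous_toFun := by fun_prop
  continuous_invFun := by
    refine continuous_pi fun i => ?_
    refine Fin.lastCases ?_ (fun i => ?_) i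
    · simpa using continuous_snd
    · simp only [Fin.snoc_castSucc]; fun_prop

theorem snocHomeo_mem {m : ℕ} (y : Fin (m + 1) → I) :
    y ∈ Cube.boundary (Fin (m + 1)) ↔ snocHomeo m y ∈ bd m := by
  constructor
  · rintro ⟨i, hi⟩
    induction i using Fin.lastCases with
    | last => exact Or.inr hi
    | cast i => exact Or.inl ⟨i, hi⟩
  · rintro (⟨i, hi⟩ | hi)
    · exact ⟨i.castSucc, hi⟩
    · exact ⟨Fin.last m, hi⟩

/-- Solve the problem in the based case. -/
theorem solv_const (hp : HLP p) (e : E) (hinj : Function.Injective (piMap p (Fin m) e))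
    (hsurj : Function.Surjective (piMap p (Fin (m + 1)) e)) (g : C((Fin m → I), E))
    (hg : ∀ y ∈ Cube.boundary (Fin m), g y = e) (hpg : ∀ y, p (g y) = p e) :
    Solv p (ContinuousMap.const ((Fin m → I) × I) e) g := by
  let gl : GenLoop (Fin m) E e := ⟨g, hg⟩
  have h1 : GenLoop.Homotopic (GenLoop.const : GenLoop (Fin m) E e) gl := by
    refine Quotient.exact (hinj ?_)
    refine Quotient.sound (genLoop_homotopic (ContinuousMap.const _ (p e)) ?_ ?_ ?_)
    · intro y; rfl
    · intro y; exact (hpg y).symm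
    · intro y _ t; rfl
  obtain ⟨G, G0, G1, Gb⟩ := exists_of_genLoop_homotopic h1
  replace G0 : ∀ y, G (y, 0) = e := G0
  replace G1 : ∀ y, G (y, 1) = g y := G1
  have Gbd : ∀ y ∈ bd m, p (G y) = p e := by
    rintro ⟨y, t⟩ (h | (h | h))
    · rw [Gb y h]
    · obtain rfl : t = 0 := h; rw [G0]
    · obtain rfl : t = 1 := h; rw [G1, hpg]
  let k := snocHomeo m
  let pl : GenLoop (Fin (m + 1)) B (p e) := ⟨⟨fun y => p (G (k y)), by fun_prop⟩,
    fun y hy => Gbd _ ((snocHomeo_mem y).1 hy)⟩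
  obtain ⟨q, hq⟩ := hsurj (Quotient.mk _ pl)
  induction q using Quotient.inductionOn with | _ l => ?_
  obtain ⟨M, M0, M1, Mb⟩ := exists_of_genLoop_homotopic (Quotient.exact hq)
  replace M0 : ∀ y, M (y, 0) = p (l y) := M0
  replace M1 : ∀ y, M (y, 1) = p (G (k y)) := M1
  have hkb : ∀ y ∈ bd m, k.symm y ∈ Cube.boundary (Fin (m + 1)) := fun y hy => by
    rw [snocHomeo_mem]; simpa [k] using hy
  have lc : Continuous l := l.1.continuous
  have lb : ∀ y ∈ Cube.boundary (Fin (m + 1)), l y = e := l.2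
  let α : I → I := fun t => Set.projIcc (0 : ℝ) 1 zero_le_one (1 - 2 * t)
  let β : I → I := fun t => Set.projIcc (0 : ℝ) 1 zero_le_one (2 * t - 1)
  have αc : Continuous α := continuous_projIcc.comp (by fun_prop)
  have βc : Continuous β := continuous_projIcc.comp (by fun_prop)
  have α0 : α 0 = 1 := by simp [α, Set.projIcc_of_right_le]
  have β1 : β 1 = 1 := Set.projIcc_of_right_le _ (by norm_num)
  have αz : ∀ t : I, (1 / 2 : ℝ) ≤ t → α t = 0 := fun t ht =>
    Set.projIcc_of_le_left _ (by linarith)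
  have βz : ∀ t : I, (t : ℝ) ≤ 1 / 2 → β t = 0 := fun t ht =>
    Set.projIcc_of_le_left _ (by linarith)
  let G' : C((Fin m → I) × I, E) := ⟨fun y => if (y.2 : ℝ) ≤ 1 / 2 then l (k.symm (y.1, α y.2))
    else G (y.1, β y.2), by
      refine Continuous.if_le (by fun_prop) (by fun_prop) (by fun_prop) (by fun_prop) ?_
      rintro ⟨y, t⟩ ht
      dsimp only at ht ⊢
      rw [αz t ht.ge, βz t ht.le, G0]
      exact lb _ (hkb _ (Or.inr (Or.inl rfl)))⟩
  have G'lt : ∀ y (t : I), (t : ℝ) ≤ 1 / 2 → G' (y, t) = l (k.symm (y, α t)) := fun y t ht =>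
    if_pos ht
  have G'gt : ∀ y (t : I), ¬ (t : ℝ) ≤ 1 / 2 → G' (y, t) = G (y, β t) := fun y t ht =>
    if_neg ht
  have G'0 : ∀ y, G' (y, 0) = e := fun y => by
    rw [G'lt _ _ (by simp), α0]; exact lb _ (hkb _ (Or.inr (Or.inr rfl)))
  have G'1 : ∀ y, G' (y, 1) = g y := fun y => by
    rw [G'gt _ _ (by norm_num), β1, G1]
  have G'b : ∀ y ∈ Cube.boundary (Fin m), ∀ t, G' (y, t) = e := fun y hy t => by
    by_cases ht : (t : ℝ) ≤ 1 / 2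
    · rw [G'lt _ _ ht]; exact lb _ (hkb _ (Or.inl hy))
    · rw [G'gt _ _ ht, Gb y hy]
  have G'bd : ∀ y ∈ bd m, p (G' y) = p e := by
    rintro ⟨y, t⟩ (h | (h | h))
    · rw [G'b y h]
    · obtain rfl : t = 0 := h; rw [G'0]
    · obtain rfl : t = 1 := h; rw [G'1, hpg]
  let V1 : C(((Fin m → I) × I) × I, B) := ⟨fun y => if (y.1.2 : ℝ) ≤ 1 / 2 then
      M (k.symm (y.1.1, α y.1.2), y.2) else p (G (y.1.1, β y.1.2)), by
      refine Continuous.if_le (by fun_prop) (by fun_prop) (by fun_prop) (by fun_prop) ?_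
      rintro ⟨⟨y, t⟩, s⟩ ht
      dsimp only at ht ⊢
      rw [αz t ht.ge, βz t ht.le, G0]
      exact Mb _ (hkb _ (Or.inr (Or.inl rfl))) _⟩
  have V1lt : ∀ y (t s : I), (t : ℝ) ≤ 1 / 2 → V1 ((y, t), s) = M (k.symm (y, α t), s) :=
    fun y t s ht => if_pos ht
  have V1gt : ∀ y (t s : I), ¬ (t : ℝ) ≤ 1 / 2 → V1 ((y, t), s) = p (G (y, β t)) :=
    fun y t s ht => if_neg ht
  let V2 : C(((Fin m → I) × I) × I, B) :=
    ⟨fun y => p (G (y.1.1, max (max (α y.1.2) (β y.1.2)) y.2)), by fun_prop⟩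
  have V1bd : ∀ y ∈ bd m, ∀ s, V1 (y, s) = p e := by
    rintro ⟨y, t⟩ h s
    by_cases ht : (t : ℝ) ≤ 1 / 2
    · rw [V1lt _ _ _ ht]
      refine Mb _ (hkb _ ?_) _
      rcases h with h | h | h
      · exact Or.inl h
      · obtain rfl : t = 0 := h
        exact Or.inr (Or.inr α0)
      · obtain rfl : t = 1 := h
        norm_num at ht
    · rw [V1gt _ _ _ ht]
      rcases h with h | h | h
      · rw [Gb y h]
      · obtain rfl : t = 0 := h
        norm_num at ht
      · obtain rfl : t = 1 := h
        rw [β1, G1, hpg]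
  obtain ⟨w1, w1b, w1p⟩ := solve_of_homotopy hp (fun y => G' y.1) (by fun_prop) V1 (by
    intro y hy s
    rw [V1bd y hy, G'bd y hy]) G' (fun _ _ => rfl) (by
    rintro ⟨y, t⟩
    by_cases ht : (t : ℝ) ≤ 1 / 2
    · rw [V1lt _ _ _ ht, G'lt _ _ ht, M0]
    · rw [V1gt _ _ _ ht, G'gt _ _ ht])
  obtain ⟨w2, w2b, w2p⟩ := solve_of_homotopy hp (fun y => G' y.1) (by fun_prop) V2 (by
    rintro ⟨y, t⟩ hy s
    rw [G'bd _ hy]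
    symm
    show p (G (y, max (max (α t) (β t)) s)) = p e
    rcases hy with h | h | h
    · rw [Gb y h]
    · obtain rfl : t = 0 := h
      rw [α0, max_eq_left (le_one' : β 0 ≤ 1), max_eq_left (le_one' : s ≤ 1), G1, hpg]
    · obtain rfl : t = 1 := h
      rw [β1, max_eq_right (le_one' : α 1 ≤ 1), max_eq_left (le_one' : s ≤ 1), G1, hpg])
    w1 w1b (by
    rintro ⟨y, t⟩
    rw [w1p]
    show _ = p (G (y, max (max (α t) (β t)) 0))
    rw [max_eq_left (nonneg' : 0 ≤ max (α t) (β t))]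
    by_cases ht : (t : ℝ) ≤ 1 / 2
    · rw [V1lt _ _ _ ht, M1, βz t ht, max_eq_left (nonneg' : 0 ≤ α t)]; simp
    · rw [V1gt _ _ _ ht, αz t (by linarith), max_eq_right (nonneg' : 0 ≤ β t)])
  refine ⟨w2, fun y hy t => ?_, fun y => ?_, fun y => ?_, fun ⟨y, t⟩ => ?_⟩
  · rw [w2b _ (Or.inl hy)]; exact G'b y hy t
  · rw [w2b _ (Or.inr (Or.inl rfl))]; exact G'0 y
  · rw [w2b _ (Or.inr (Or.inr rfl))]; exact G'1 y
  · rw [w2p]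
    show p (G (y, max (max (α t) (β t)) 1)) = p e
    rw [max_eq_right (le_one' : max (α t) (β t) ≤ 1), G1, hpg]

theorem cube_lifts (hp : HLP p) (hE : ∀ e : E, ∃ P : C(I, E), P 0 = e ∧
    ∀ n, Function.Bijective (piMap p (Fin n) (P 1))) (m : ℕ) :
    Lifts p ((Fin m → I) × I) (bd m) := by
  intro u v hu huv
  obtain ⟨w, hw, hpw⟩ := good_cube m hp u v (hu.mono (by
    rintro ⟨y, t⟩ (h | h)
    · exact Or.inr (Or.inl h)
    · exact Or.inl h)) (by
    rintro ⟨y, t⟩ (h | h)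
    · exact huv _ (Or.inr (Or.inl h))
    · exact huv _ (Or.inl h))
  let g : C(Fin m → I, E) := ⟨fun y => u (y, 1),
    hu.comp_continuous (by fun_prop) (fun y => Or.inr (Or.inr rfl))⟩
  let W : C(((Fin m → I) × I) × I, E) :=
    ⟨fun y => w (fun i => σ y.2 * y.1.1 i, σ y.2 * y.1.2), by fun_prop⟩
  obtain ⟨P, P0, hP⟩ := hE (w (fun _ => 0, 0))
  obtain ⟨g1, g1b, g1p, g1s⟩ := solv_move hp W w (ContinuousMap.const _ (w (fun _ => 0, 0)))
    (by rintro ⟨y, t⟩; simp [W]) (by rintro ⟨y, t⟩; simp [W]) g (by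
      intro y hy; exact (hw _ (Or.inr hy)).symm) (by
      intro y; rw [hpw]; exact huv _ (Or.inr (Or.inr rfl)))
  obtain ⟨g2, g2b, g2p, g2s⟩ := solv_move hp ⟨fun y => P y.2, by fun_prop⟩
    (ContinuousMap.const _ (w (fun _ => 0, 0))) (ContinuousMap.const _ (P 1))
    (by intro y; simp [P0]) (by intro y; simp) g1 g1b g1p
  obtain ⟨w', h1, h2, h3, h4⟩ := g1s (g2s (solv_const hp (P 1) (hP m).1 (hP (m + 1)).2 g2 g2b g2p))
  refine ⟨w', ?_, fun y => (h4 y).trans (hpw y)⟩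
  rintro ⟨y, t⟩ (h | h | h)
  · rw [h1 y h]; exact hw _ (Or.inr h)
  · obtain rfl : t = 0 := h
    rw [h2]; exact hw _ (Or.inl rfl)
  · obtain rfl : t = 1 := h
    exact h3 y

end Core

/-! ### The mapping path space -/

section NPath

variable {A B : Type} [TopologicalSpace A] [TopologicalSpace B]

/-- The mapping path space. -/
abbrev NPath (h : A → B) : Type := {q : A × C(I, B) // q.2 0 = h q.1}

/-- Evaluation at the end point. -/
def NPath.ev (h : A → B) : C(NPath h, B) := ⟨fun q => q.1.2 1, by fun_prop⟩

theorem NPath.continuous_mk {Z : Type} [TopologicalSpace Z] (h : A → B) (a : Z → A)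
    (ha : Continuous a) (γ : C(Z × I, B)) (H : ∀ z, γ.curry z 0 = h (a z)) :
    Continuous (fun z => (⟨(a z, γ.curry z), H z⟩ : NPath h)) :=
  Continuous.subtype_mk (ha.prodMk γ.curry.continuous) _

theorem NPath.hlp (h : A → B) : HLP (NPath.ev h) := by
  intro Z _ H k hk
  replace hk : ∀ z, (k z).1.2 1 = H (z, 0) := hk
  let c : (Z × I) × I → ℝ := fun y => (y.2 : ℝ) * (1 + (y.1.2 : ℝ))
  have hc : Continuous c := by fun_prop
  let G : C((Z × I) × I, B) := ⟨fun y => if c y ≤ 1 then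
      (k y.1.1).1.2 (Set.projIcc (0 : ℝ) 1 zero_le_one (c y)) else
      H (y.1.1, Set.projIcc (0 : ℝ) 1 zero_le_one (c y - 1)), by
    have c1 : Continuous fun y => Set.projIcc (0 : ℝ) 1 zero_le_one (c y) :=
      continuous_projIcc.comp hc
    have c2 : Continuous fun y => Set.projIcc (0 : ℝ) 1 zero_le_one (c y - 1) :=
      continuous_projIcc.comp (by fun_prop)
    refine Continuous.if_le (by fun_prop) (by fun_prop) hc continuous_const ?_
    intro y hy
    rw [hy, Set.projIcc_of_right_le _ le_rfl, Set.projIcc_of_le_left _ (by norm_num)]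
    exact hk _⟩
  have G0 : ∀ y, G.curry y 0 = h (k y.1).1.1 := by
    intro y
    show (if c (y, 0) ≤ 1 then _ else _) = _
    have : c (y, 0) = 0 := by simp [c]
    rw [this, if_pos zero_le_one, Set.projIcc_of_le_left _ le_rfl]
    exact (k y.1).2
  refine ⟨⟨fun y => ⟨((k y.1).1.1, G.curry y), G0 y⟩, NPath.continuous_mk h _ (by fun_prop) G G0⟩,
    fun z => ?_, fun y => ?_⟩
  · apply Subtype.ext
    refine Prod.ext rfl ?_
    ext t
    show (if c ((z, 0), t) ≤ 1 then _ else _) = _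
    have : c ((z, 0), t) = t := by simp [c]
    rw [this, if_pos t.2.2, Set.projIcc_val]
  · show (if c (y, 1) ≤ 1 then _ else _) = _
    have : c (y, 1) = 1 + y.2 := by simp [c]
    rw [this]
    split_ifs with h1
    · have h0 : y.2 = 0 := Subtype.ext (le_antisymm (by simpa using h1) y.2.2.1)
      rw [Set.projIcc_of_right_le _ (by linarith [y.2.2.1])]
      show (k y.1).1.2 1 = _
      rw [hk, ← h0]
    · rw [add_sub_cancel_left, Set.projIcc_val]

/-- Shrinking paths to their origin. -/
def NPath.shrink (h : A → B) : C(NPath h × I, NPath h) :=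
  ⟨fun y => ⟨(y.1.1.1, (⟨fun z => z.1.1.1.2 (z.2 * σ z.1.2), by fun_prop⟩ :
      C((NPath h × I) × I, B)).curry y), by
      have := y.1.2
      simpa using this⟩, NPath.continuous_mk h (fun y : NPath h × I => y.1.1.1) (by fun_prop) _ _⟩

/-- Constant paths. -/
def NPath.const (h : C(A, B)) : C(A, NPath h) :=
  ⟨fun a => ⟨(a, (⟨fun z => h z.1, by fun_prop⟩ : C(A × I, B)).curry a), rfl⟩,
    NPath.continuous_mk h (fun a : A => a) (by fun_prop) _ _⟩

theorem NPath.shrink_zero (h : A → B) (q : NPath h) : NPath.shrink h (q, 0) = q := by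
  apply Subtype.ext
  refine Prod.ext rfl ?_
  ext t
  simp [NPath.shrink]

theorem NPath.shrink_one (h : C(A, B)) (q : NPath h) :
    NPath.shrink h (q, 1) = NPath.const h q.1.1 := by
  apply Subtype.ext
  refine Prod.ext rfl ?_
  ext t
  have := q.2
  simpa [NPath.shrink, NPath.const] using this

theorem NPath.weak_const (h : C(A, B)) : IsWeakHomotopyEquiv (NPath.const h) := by
  refine weak_of_homotopy_equiv _ ⟨fun q => q.1.1, by fun_prop⟩ ?_ ?_
  · exact ContinuousMap.Homotopic.refl _
  · exact ⟨{ toFun := fun y => NPath.shrink h (y.2, y.1)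
             continuous_toFun := by fun_prop
             map_zero_left := fun q => NPath.shrink_zero h q
             map_one_left := fun q => NPath.shrink_one h q }⟩

theorem NPath.cube_lifts {h : C(A, B)} (hh : IsWeakHomotopyEquiv h) (m : ℕ) :
    Lifts (NPath.ev h) ((Fin m → I) × I) (bd m) := by
  refine Gaucher.cube_lifts (NPath.hlp h) (fun q => ?_) m
  refine ⟨⟨fun t => NPath.shrink h (q, t), by fun_prop⟩, NPath.shrink_zero h q, fun n => ?_⟩
  show Function.Bijective (piMap (NPath.ev h) (Fin n) (NPath.shrink h (q, 1)))
  rw [NPath.shrink_one]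
  have h1 := hh.2 q.1.1 n
  have h2 := (NPath.weak_const h).2 q.1.1 n
  have h3 : Function.Bijective (piMap ((NPath.ev h).comp (NPath.const h)) (Fin n) q.1.1) := h1
  rw [piMap_comp] at h3
  exact (Function.Bijective.of_comp_iff _ h2).1 h3

theorem NPath.disk_lifts {h : C(A, B)} (hh : IsWeakHomotopyEquiv h) (n : ℕ) :
    Lifts (NPath.ev h) (closedDisk n)
      {y | (y : EuclideanSpace ℝ (Fin n)) ∈ Metric.sphere (0 : EuclideanSpace ℝ (Fin n)) 1} := by
  cases n with
  | zero =>
    intro u v hu huv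
    have hs : ∀ y y' : closedDisk 0, y = y' := fun y y' => Subtype.ext (Subsingleton.elim _ _)
    have hs' : ∀ y : closedDisk 0,
        (y : EuclideanSpace ℝ (Fin 0)) ∉ Metric.sphere (0 : EuclideanSpace ℝ (Fin 0)) 1 := by
      intro y hy
      rw [mem_sphere_zero_iff_norm, Subsingleton.elim (y : EuclideanSpace ℝ (Fin 0)) 0,
        norm_zero] at hy
      exact zero_ne_one hy
    let y0 : closedDisk 0 := ⟨0, by simp⟩
    obtain ⟨q, hq⟩ := hh.1.2 (Quotient.mk _ (v y0))
    induction q using Quotient.inductionOn with | _ a => ?_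
    obtain ⟨γ⟩ : Joined (h a) (v y0) := Quotient.exact hq
    refine ⟨ContinuousMap.const _ ⟨(a, γ.toContinuousMap), γ.source⟩,
      fun y hy => absurd hy (hs' y), fun y => ?_⟩
    rw [hs y y0]
    exact γ.target
  | succ m =>
    obtain ⟨e, he⟩ := exists_disk_homeo m
    exact (NPath.cube_lifts hh m).homeo e he

end NPath

/-! ### Flows -/

theorem Flow.s_path (Y : Flow) (γ : C(I, Y.Path)) (a b : I) : Y.s (γ a) = Y.s (γ b) := by
  have hs : Continuous Y.s := continuous_discrete_rng.2 Y.isOpen_preimage_s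
  exact PreconnectedSpace.constant inferInstance (hs.comp γ.continuous)

theorem Flow.t_path (Y : Flow) (γ : C(I, Y.Path)) (a b : I) : Y.t (γ a) = Y.t (γ b) := by
  have ht : Continuous Y.t := continuous_discrete_rng.2 Y.isOpen_preimage_t
  exact PreconnectedSpace.constant inferInstance (ht.comp γ.continuous)

section MapPath

variable {X Y : Flow} (f : FlowHom X Y)

theorem mapPath_s (q : NPath f.toFunP) (r : I) : Y.s (q.1.2 r) = f.toFun0 (X.s q.1.1) := by
  rw [Y.s_path q.1.2 r 0, q.2, f.s_map]

theorem mapPath_t (q : NPath f.toFunP) (r : I) : Y.t (q.1.2 r) = f.toFun0 (X.t q.1.1) := by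
  rw [Y.t_path q.1.2 r 0, q.2, f.t_map]

theorem mapPath_ts (q q' : NPath f.toFunP) (h : X.t q.1.1 = X.s q'.1.1) (r : I) :
    Y.t (q.1.2 r) = Y.s (q'.1.2 r) := by
  rw [mapPath_s, mapPath_t, h]

/-- Pointwise composition of composable pairs of paths of paths. -/
def mapPathComp : C({z : NPath f.toFunP × NPath f.toFunP // X.t z.1.1.1 = X.s z.2.1.1} × I,
    Y.Path) :=
  ⟨fun z => Y.comp (z.1.1.1.1.2 z.2) (z.1.1.2.1.2 z.2) (mapPath_ts f _ _ z.1.2 z.2), by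
    exact Y.continuous_comp.comp (Continuous.subtype_mk
      (f := fun z : {z : NPath f.toFunP × NPath f.toFunP // X.t z.1.1.1 = X.s z.2.1.1} × I =>
        (z.1.1.1.1.2 z.2, z.1.1.2.1.2 z.2)) (by fun_prop)
      (fun z => mapPath_ts f _ _ z.1.2 z.2))⟩

theorem mapPathComp_zero (z) : (mapPathComp f).curry z 0 =
    f.toFunP (X.comp z.1.1.1.1 z.1.2.1.1 z.2) := by
  have h1 := z.1.1.2
  have h2 := z.1.2.2
  have h3 : Y.t (f.toFunP z.1.1.1.1) = Y.s (f.toFunP z.1.2.1.1) := by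
    rw [f.t_map, f.s_map, z.2]
  rw [f.comp_map _ _ _ h3]
  show Y.comp _ _ _ = _
  congr 1

/-- The mapping path flow of `f`. -/
def mapPathFlow : Flow where
  State := X.State
  Path := NPath f.toFunP
  s q := X.s q.1.1
  t q := X.t q.1.1
  isOpen_preimage_s a := (X.isOpen_preimage_s a).preimage
    (f := fun q : NPath f.toFunP => q.1.1) (by fun_prop)
  isOpen_preimage_t a := (X.isOpen_preimage_t a).preimage
    (f := fun q : NPath f.toFunP => q.1.1) (by fun_prop)
  comp q q' h := ⟨(X.comp q.1.1 q'.1.1 h, (mapPathComp f).curry ⟨(q, q'), h⟩),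
    mapPathComp_zero f ⟨(q, q'), h⟩⟩
  continuous_comp := by
    refine NPath.continuous_mk f.toFunP
      (fun z : {z : NPath f.toFunP × NPath f.toFunP // X.t z.1.1.1 = X.s z.2.1.1} =>
        X.comp z.1.1.1.1 z.1.2.1.1 z.2) ?_ (mapPathComp f) (mapPathComp_zero f)
    exact X.continuous_comp.comp (Continuous.subtype_mk
      (f := fun z : {z : NPath f.toFunP × NPath f.toFunP // X.t z.1.1.1 = X.s z.2.1.1} =>
        (z.1.1.1.1, z.1.2.1.1)) (by fun_prop) (fun z => z.2))
  s_comp q q' h := X.s_comp _ _ _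
  t_comp q q' h := X.t_comp _ _ _
  comp_assoc q q' q'' h h' h1 h2 := by
    apply Subtype.ext
    refine Prod.ext (X.comp_assoc _ _ _ _ _ _ _) ?_
    ext r
    exact Y.comp_assoc _ _ _ _ _ _ _

/-- Projection of the mapping path flow to the source. -/
def mapPathProj : FlowHom (mapPathFlow f) X where
  toFun0 := _root_.id
  toFunP q := q.1.1
  continuous_toFunP := (by fun_prop : Continuous (fun q : NPath f.toFunP => q.1.1))
  s_map _ := rfl
  t_map _ := rfl
  comp_map _ _ _ _ := rfl

/-- Evaluation of the mapping path flow at a time. -/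
def mapPathEv (r : I) : FlowHom (mapPathFlow f) Y where
  toFun0 := f.toFun0
  toFunP q := q.1.2 r
  continuous_toFunP := (by fun_prop : Continuous (fun q : NPath f.toFunP => q.1.2 r))
  s_map q := mapPath_s f q r
  t_map q := mapPath_t f q r
  comp_map _ _ _ _ := rfl

theorem mapPathEv_zero : mapPathEv f 0 = f.comp (mapPathProj f) :=
  FlowHom.ext rfl (funext fun q => q.2)

theorem FlowHom.congr0 {X Y : Flow} {f g : FlowHom X Y} (h : f = g) (x : X.State) :
    f.toFun0 x = g.toFun0 x := by rw [h]

theorem FlowHom.congrP {X Y : Flow} {f g : FlowHom X Y} (h : f = g) (x : X.Path) :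
    f.toFunP x = g.toFunP x := by rw [h]

theorem disk_lift_aux {E B : Type} [TopologicalSpace E] [TopologicalSpace B] {p : C(E, B)} {n : ℕ}
    (hp : Lifts p (closedDisk n)
      {y | (y : EuclideanSpace ℝ (Fin n)) ∈ Metric.sphere (0 : EuclideanSpace ℝ (Fin n)) 1})
    (hne : Nonempty B → Nonempty E) (u0 : C(diskBoundary n, E)) (v : C(closedDisk n, B))
    (h : ∀ y, p (u0 y) = v (diskBoundaryInclusion n y)) :
    ∃ w : C(closedDisk n, E), (∀ y, p (w y) = v y) ∧
      ∀ y, w (diskBoundaryInclusion n y) = u0 y := by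
  classical
  obtain ⟨e0⟩ := hne ⟨v ⟨0, by simp⟩⟩
  let u : closedDisk n → E := fun y =>
    if hy : (y : EuclideanSpace ℝ (Fin n)) ∈
      Metric.sphere (0 : EuclideanSpace ℝ (Fin n)) 1 then u0 ⟨y, hy⟩ else e0
  have hu : ∀ (y : closedDisk n) (hy : (y : EuclideanSpace ℝ (Fin n)) ∈
      Metric.sphere (0 : EuclideanSpace ℝ (Fin n)) 1), u y = u0 ⟨y, hy⟩ := fun y hy =>
    dif_pos hy
  obtain ⟨w, hw, hw'⟩ := hp u v (by
    rw [continuousOn_iff_continuous_domRestrict]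
    have hc : Continuous (fun y : {y : closedDisk n | (y : EuclideanSpace ℝ (Fin n)) ∈
        Metric.sphere (0 : EuclideanSpace ℝ (Fin n)) 1} =>
        u0 (⟨y.1.1, y.2⟩ : diskBoundary n)) :=
      u0.continuous.comp (Continuous.subtype_mk
        (continuous_subtype_val.comp continuous_subtype_val) _)
    exact hc.congr (fun y => (hu y.1 y.2).symm)) (by
    intro y hy
    rw [hu y hy]
    exact h ⟨y.1, hy⟩)
  refine ⟨w, hw', fun y => ?_⟩
  have h1 := hw (diskBoundaryInclusion n y) y.2
  rw [hu (diskBoundaryInclusion n y) y.2] at h1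
  exact h1

/-- A trivial fibration lifts against S-cofibrant flows. -/
theorem exists_lift {E Y Z : Flow} (hZ : SCofibrantStructure Z) (p : FlowHom E Y)
    (h0 : Function.Bijective p.toFun0)
    (hp : ∀ n, Lifts p.pathMap (closedDisk n)
      {y | (y : EuclideanSpace ℝ (Fin n)) ∈ Metric.sphere (0 : EuclideanSpace ℝ (Fin n)) 1})
    (hne : Nonempty Y.Path → Nonempty E.Path)
    (g : FlowHom Z Y) : ∃ h : FlowHom Z E, p.comp h = g := by
  classical
  let inv : Y.State → E.State := Function.surjInv h0.2
  have hinv : ∀ y, p.toFun0 (inv y) = y := Function.surjInv_eq h0.2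
  have step : ∀ n (d : FlowHom (hZ.sk n) E), p.comp d = g.comp (hZ.incl n) →
      ∃ d' : FlowHom (hZ.sk (n + 1)) E, p.comp d' = g.comp (hZ.incl (n + 1)) ∧
        d'.comp (hZ.ι n) = d := by
    intro n d hd
    have hcell : ∀ i : hZ.cells n, ∃ k : FlowHom (Glob (closedDisk n)) E,
        k.comp (globBoundaryInclusion n) = d.comp (hZ.attachMap n i) ∧
        p.comp k = (g.comp (hZ.incl (n + 1))).comp (hZ.cellMap n i) := by
      intro i
      let V := (g.comp (hZ.incl (n + 1))).comp (hZ.cellMap n i)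
      have hV : V.comp (globBoundaryInclusion n) = p.comp (d.comp (hZ.attachMap n i)) := by
        show ((g.comp (hZ.incl (n + 1))).comp (hZ.cellMap n i)).comp (globBoundaryInclusion n) = _
        rw [FlowHom.comp_assoc, hZ.attach_comm, FlowHom.comp_assoc, ← FlowHom.comp_assoc (hZ.incl _),
          hZ.incl_comm, ← FlowHom.comp_assoc, ← hd, FlowHom.comp_assoc]
      let v : C(closedDisk n, Y.Path) := V.pathMap
      let u0 : C(diskBoundary n, E.Path) := (d.comp (hZ.attachMap n i)).pathMap
      have hu0 : ∀ y : diskBoundary n, p.toFunP (u0 y) = v (diskBoundaryInclusion n y) :=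
        fun y => (FlowHom.congrP hV y).symm
      obtain ⟨w, hw, hwu⟩ := disk_lift_aux (hp n) hne u0 v hu0
      refine ⟨{ toFun0 := fun a => inv (V.toFun0 a)
                toFunP := w
                continuous_toFunP := w.continuous
                s_map := fun x => h0.1 ?_
                t_map := fun x => h0.1 ?_
                comp_map := fun x y h => absurd (show (1 : Fin 2) = 0 from h) (by decide) },
              FlowHom.ext (funext fun a => h0.1 ?_) (funext fun y => hwu y),
              FlowHom.ext (funext fun a => hinv _) (funext fun y => hw y)⟩
      · rw [hinv, ← p.s_map]; exact (congrArg Y.s (hw x)).trans (V.s_map x)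
      · rw [hinv, ← p.t_map]; exact (congrArg Y.t (hw x)).trans (V.t_map x)
      · exact (hinv _).trans (FlowHom.congr0 hV a)
    choose k hk hk' using hcell
    obtain ⟨d', ⟨h1, h2⟩, -⟩ := hZ.attach_isPushout n E d k hk
    refine ⟨d', ?_, h1⟩
    obtain ⟨x, -, hx⟩ := hZ.attach_isPushout n Y (g.comp (hZ.incl n))
      (fun i => (g.comp (hZ.incl (n + 1))).comp (hZ.cellMap n i)) (by
        intro i
        rw [← hk' i, FlowHom.comp_assoc, hk i, ← hd, FlowHom.comp_assoc])
    rw [hx (p.comp d') ⟨by rw [FlowHom.comp_assoc, h1, hd], fun i => by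
        rw [FlowHom.comp_assoc, h2, hk']⟩,
      hx (g.comp (hZ.incl (n + 1))) ⟨by rw [FlowHom.comp_assoc, hZ.incl_comm], fun i => rfl⟩]
  have := hZ.isEmpty_path_sk_zero
  let d0 : FlowHom (hZ.sk 0) E :=
    { toFun0 := fun a => inv ((g.comp (hZ.incl 0)).toFun0 a)
      toFunP := fun x => isEmptyElim x
      continuous_toFunP := continuous_of_isEmpty _
      s_map := fun x => isEmptyElim x
      t_map := fun x => isEmptyElim x
      comp_map := fun x => isEmptyElim x }
  have hd0 : p.comp d0 = g.comp (hZ.incl 0) :=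
    FlowHom.ext (funext fun a => hinv _) (funext fun x => isEmptyElim x)
  choose nx hnx hnx' using step
  let d : ∀ n, {d : FlowHom (hZ.sk n) E // p.comp d = g.comp (hZ.incl n)} := fun n =>
    Nat.rec ⟨d0, hd0⟩ (fun n d => ⟨nx n d.1 d.2, hnx n d.1 d.2⟩) n
  obtain ⟨h, hh, -⟩ := hZ.isColimit E (fun n => (d n).1) (fun n => hnx' n (d n).1 (d n).2)
  refine ⟨h, ?_⟩
  obtain ⟨x, -, hx⟩ := hZ.isColimit Y (fun n => g.comp (hZ.incl n)) (fun n => by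
    rw [FlowHom.comp_assoc, hZ.incl_comm])
  rw [hx (p.comp h) (fun n => by rw [FlowHom.comp_assoc, hh]; exact (d n).2), hx g (fun n => rfl)]

theorem exists_homotopy_lift {Z : Flow} (hf : IsWeakSHomotopyEquiv f) (hZ : SCofibrant Z)
    (g : FlowHom Z Y) : ∃ g' : FlowHom Z X, SHomotopy (f.comp g') g := by
  obtain ⟨hZ⟩ := hZ
  obtain ⟨h, hh⟩ := exists_lift hZ (mapPathEv f 1) hf.1
    (fun n => NPath.disk_lifts (h := f.pathMap) hf.2 n) (fun hy => by
      obtain ⟨y⟩ := hy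
      obtain ⟨a, -⟩ := hf.2.1.2 (Quotient.mk _ y)
      induction a using Quotient.inductionOn with
      | h a => exact ⟨NPath.const f.pathMap a⟩) g
  refine ⟨(mapPathProj f).comp h, fun r => (mapPathEv f r).comp h, ?_, hh, ?_, ?_⟩
  · show (mapPathEv f 0).comp h = _
    rw [mapPathEv_zero, FlowHom.comp_assoc]
  · have h1 : Continuous (fun z : Z.Path => (h.toFunP z : NPath f.toFunP)) := h.continuous_toFunP
    have h2 : Continuous (fun q : NPath f.toFunP × I => q.1.1.2 q.2) := by fun_prop
    exact h2.comp (h1.prodMap continuous_id)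
  · have h1 : Continuous (fun z : Z.State => f.toFun0 (h.toFun0 z)) :=
      continuous_of_discreteTopology
    exact h1.comp continuous_fst

end MapPath

/-! ### S-homotopy is a congruence -/

theorem SHomotopy.symm {X Y : Flow} {f g : FlowHom X Y} (h : SHomotopy f g) : SHomotopy g f := by
  obtain ⟨F, F0, F1, c1, c2⟩ := h
  refine ⟨fun r => F (σ r), by simp [F1], by simp [F0], ?_, ?_⟩
  · exact c1.comp (by fun_prop : Continuous fun q : X.Path × I => (q.1, σ q.2))
  · exact c2.comp (by fun_prop : Continuous fun q : X.State × I => (q.1, σ q.2))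

theorem continuous_trans_aux {T S : Type} [TopologicalSpace T] [TopologicalSpace S]
    {a b : I → T → S} (ha : Continuous fun q : T × I => a q.2 q.1)
    (hb : Continuous fun q : T × I => b q.2 q.1) (hab : ∀ x, a 1 x = b 0 x) :
    Continuous fun q : T × I => if (q.2 : ℝ) ≤ 1 / 2 then
      a (Set.projIcc (0 : ℝ) 1 zero_le_one (2 * q.2)) q.1 else
      b (Set.projIcc (0 : ℝ) 1 zero_le_one (2 * q.2 - 1)) q.1 := by
  refine Continuous.if_le ?_ ?_ (by fun_prop) (by fun_prop) ?_
  · have c1 : Continuous fun q : T × I => Set.projIcc (0 : ℝ) 1 zero_le_one (2 * (q.2 : ℝ)) :=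
      continuous_projIcc.comp (by fun_prop)
    exact ha.comp (continuous_fst.prodMk c1)
  · have c1 : Continuous fun q : T × I => Set.projIcc (0 : ℝ) 1 zero_le_one (2 * (q.2 : ℝ) - 1) :=
      continuous_projIcc.comp (by fun_prop)
    exact hb.comp (continuous_fst.prodMk c1)
  · intro q hq
    rw [hq, Set.projIcc_of_right_le _ (by norm_num), Set.projIcc_of_le_left _ (by norm_num)]
    exact hab _

theorem SHomotopy.trans {X Y : Flow} {f g k : FlowHom X Y} (h : SHomotopy f g)
    (h' : SHomotopy g k) : SHomotopy f k := by
  obtain ⟨F, F0, F1, c1, c2⟩ := h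
  obtain ⟨G, G0, G1, d1, d2⟩ := h'
  refine ⟨fun r => if (r : ℝ) ≤ 1 / 2 then F (Set.projIcc (0 : ℝ) 1 zero_le_one (2 * r)) else
      G (Set.projIcc (0 : ℝ) 1 zero_le_one (2 * r - 1)), ?_, ?_, ?_, ?_⟩
  · beta_reduce
    have h0 : ((0 : I) : ℝ) ≤ 1 / 2 := by simp
    rw [if_pos h0, Set.projIcc_of_le_left _ (by simp)]; exact F0
  · beta_reduce
    have h0 : ¬ ((1 : I) : ℝ) ≤ 1 / 2 := by norm_num
    rw [if_neg h0, Set.projIcc_of_right_le _ (by norm_num)]; exact G1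
  · refine (continuous_trans_aux (a := fun r => (F r).toFunP) (b := fun r => (G r).toFunP)
      c1 d1 (fun x => ?_)).congr (fun q => ?_)
    · show (F 1).toFunP x = (G 0).toFunP x
      rw [F1, G0]
    · dsimp only
      split_ifs <;> rfl
  · refine (continuous_trans_aux (a := fun r => (F r).toFun0) (b := fun r => (G r).toFun0)
      c2 d2 (fun x => ?_)).congr (fun q => ?_)
    · show (F 1).toFun0 x = (G 0).toFun0 x
      rw [F1, G0]
    · dsimp only
      split_ifs <;> rfl

theorem SHomotopy.comp_left {X Y Z : Flow} {f g : FlowHom X Y} (h : SHomotopy f g)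
    (k : FlowHom Y Z) : SHomotopy (k.comp f) (k.comp g) := by
  obtain ⟨F, rfl, rfl, c1, c2⟩ := h
  exact ⟨fun r => k.comp (F r), rfl, rfl, k.continuous_toFunP.comp c1,
    (continuous_of_discreteTopology (f := k.toFun0)).comp c2⟩

theorem SHomotopy.comp_right {X Y Z : Flow} {f g : FlowHom Y Z} (h : SHomotopy f g)
    (k : FlowHom X Y) : SHomotopy (f.comp k) (g.comp k) := by
  obtain ⟨F, rfl, rfl, c1, c2⟩ := h
  exact ⟨fun r => (F r).comp k, rfl, rfl,
    c1.comp (k.continuous_toFunP.prodMap continuous_id),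
    c2.comp ((continuous_of_discreteTopology (f := k.toFun0)).prodMap continuous_id)⟩

theorem SHomotopy.toFun0_eq {X Y : Flow} {f g : FlowHom X Y} (h : SHomotopy f g) :
    f.toFun0 = g.toFun0 := by
  obtain ⟨F, rfl, rfl, c1, c2⟩ := h
  funext x
  exact PreconnectedSpace.constant (inferInstance : PreconnectedSpace I)
    (f := fun r => (F r).toFun0 x) (c2.comp (by fun_prop : Continuous fun r : I => (x, r)))

theorem SHomotopy.pathMap_homotopic {X Y : Flow} {f g : FlowHom X Y} (h : SHomotopy f g) :
    ContinuousMap.Homotopic f.pathMap g.pathMap := by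
  obtain ⟨F, rfl, rfl, c1, c2⟩ := h
  exact ⟨{ toFun := fun q => (F q.1).toFunP q.2
           continuous_toFun := c1.comp continuous_swap
           map_zero_left := fun _ => rfl
           map_one_left := fun _ => rfl }⟩

theorem weakSHomotopyEquiv_of_sHomotopyEquiv {X Y : Flow} {f : FlowHom X Y}
    (h : IsSHomotopyEquiv f) : IsWeakSHomotopyEquiv f := by
  obtain ⟨g, h1, h2⟩ := h
  refine ⟨Function.bijective_iff_has_inverse.2 ⟨g.toFun0, ?_, ?_⟩, ?_⟩
  · exact fun x => congrFun h2.toFun0_eq x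
  · exact fun y => congrFun h1.toFun0_eq y
  · exact weak_of_homotopy_equiv f.pathMap g.pathMap h2.pathMap_homotopic.symm
      h1.pathMap_homotopic.symm

theorem sHomotopyEquiv_of_weak {X Y : Flow} (hX : SCofibrant X) (hY : SCofibrant Y)
    (f : FlowHom X Y) (hf : IsWeakSHomotopyEquiv f) : IsSHomotopyEquiv f := by
  obtain ⟨g, hg⟩ := exists_homotopy_lift f hf hY (FlowHom.id Y)
  have hgw : IsWeakSHomotopyEquiv g := by
    refine ⟨?_, ?_⟩
    · refine bij_of_comp_left hf.1 ?_
      have : f.toFun0 ∘ g.toFun0 = _root_.id := hg.toFun0_eq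
      rw [this]
      exact Function.bijective_id
    · exact weak_of_comp_left hf.2 (weak_of_homotopic_id hg.pathMap_homotopic.symm)
  obtain ⟨f', hf'⟩ := exists_homotopy_lift g hgw hX (FlowHom.id X)
  have h1 : SHomotopy (f.comp (g.comp f')) f := hf'.comp_left f
  have h2 : SHomotopy ((f.comp g).comp f') f' := hg.comp_right f'
  have h3 : SHomotopy f f' := h1.symm.trans h2
  exact ⟨g, hg, (h3.comp_left g).trans hf'⟩

end Helpers

/-- Whitehead theorem for flows: a morphism of flows between
S-cofibrant flows is a weak S-homotopy equivalence if and only if it is an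
S-homotopy equivalence. -/
theorem weakSHomotopyEquiv_iff_sHomotopyEquiv_of_sCofibrant {X Y : Flow}
    (hX : SCofibrant X) (hY : SCofibrant Y) (f : FlowHom X Y) :
    IsWeakSHomotopyEquiv f ↔ IsSHomotopyEquiv f := by
  exact ⟨sHomotopyEquiv_of_weak hX hY f, weakSHomotopyEquiv_of_sHomotopyEquiv⟩

end Gaucher
end

section
/- Two morphisms of flows f, g : X → Y are S-homotopic if and only if there exists a morphism of flows H : [0,1] ⊠ X → Y such that H(0 ⊠ x) = f(x) and H(1 ⊠ x) = g(x) for all x ∈ X⁰ ⊔ ℙX. -/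
open CategoryTheory

namespace Gaucher

/-- two morphisms of flows `f g : X → Y` are S-homotopic if and only if
there is a morphism of flows `H : [0,1] ⊠ X → Y` with `H(0 ⊠ x) = f(x)` and
`H(1 ⊠ x) = g(x)` for every `x ∈ X⁰ ⊔ ℙX`. -/
theorem sHomotopy_iff_exists_boxTimes_homotopy (X Y B : Flow)
    (c : BoxCocone unitInterval X B) (hc : IsBoxTimes c) (f g : FlowHom X Y) :
    SHomotopy f g ↔
      ∃ H : FlowHom B Y, H.comp (c.atTime 0) = f ∧ H.comp (c.atTime 1) = g := by
  constructor
  · rintro ⟨F, rfl, rfl, hP, h0⟩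
    have key : ∀ u : unitInterval, (F u).toFun0 = (F 0).toFun0 := by
      intro u
      funext a
      have hcont : Continuous (fun v : unitInterval => (F v).toFun0 a) :=
        h0.comp (Continuous.prodMk_right a)
      exact PreconnectedSpace.constant inferInstance hcont
    let d : BoxCocone unitInterval X Y :=
      { η0 := (F 0).toFun0
        η := fun p => (F p.1).toFunP p.2
        continuous_η := hP.comp continuous_swap
        s_η := fun u x => by rw [(F u).s_map, key u]
        t_η := fun u x => by rw [(F u).t_map, key u]
        comp_η := fun u x y h h' => ((F u).comp_map x y h h').symm }
    obtain ⟨H, ⟨hH0, hHP⟩, -⟩ := hc Y d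
    refine ⟨H, FlowHom.ext hH0 ?_, FlowHom.ext (hH0.trans (key 1).symm) ?_⟩
    · funext x
      exact congrFun hHP (0, x)
    · funext x
      exact congrFun hHP (1, x)
  · rintro ⟨H, rfl, rfl⟩
    refine ⟨fun u => H.comp (c.atTime u), rfl, rfl, ?_, ?_⟩
    · exact H.continuous_toFunP.comp (c.continuous_η.comp continuous_swap)
    · exact (continuous_of_discreteTopology
        (f := fun a : X.State => H.toFun0 (c.η0 a))).comp continuous_fst

end Gaucher
end

section
/- Let f : X → Y be a morphism of flows and let I_f be its mapping cylinder. Then the canonical morphism X → I_f (induced by x ↦ 0 ⊠ x) is an S-cofibration, the canonical morphism r : I_f → Y (induced by the identity of Y and by u ⊠ x ↦ f(x)) is an S-homotopy equivalence, and f = r ∘ (X → I_f). In particular, every morphism of flows factors as an S-cofibration followed by an S-homotopy equivalence. -/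
open CategoryTheory

namespace Gaucher

-- PROOF : the cotensor flow `Z^[0,1]` and its use

theorem Flow.continuous_s (Z : Flow) : Continuous Z.s :=
  continuous_discrete_rng.2 Z.isOpen_preimage_s

theorem Flow.continuous_t (Z : Flow) : Continuous Z.t :=
  continuous_discrete_rng.2 Z.isOpen_preimage_t

theorem Flow.s_const (Z : Flow) (γ : C(unitInterval, Z.Path)) (u v : unitInterval) :
    Z.s (γ u) = Z.s (γ v) :=
  PreconnectedSpace.constant inferInstance (Z.continuous_s.comp γ.continuous)

theorem Flow.t_const (Z : Flow) (γ : C(unitInterval, Z.Path)) (u v : unitInterval) :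
    Z.t (γ u) = Z.t (γ v) :=
  PreconnectedSpace.constant inferInstance (Z.continuous_t.comp γ.continuous)

theorem Flow.composable (Z : Flow) {γ δ : C(unitInterval, Z.Path)}
    (h : Z.t (γ 0) = Z.s (δ 0)) (u : unitInterval) : Z.t (γ u) = Z.s (δ u) := by
  rw [Z.t_const γ u 0, Z.s_const δ u 0, h]

/-- The cotensor `Z^[0,1]`. -/
def cot (Z : Flow) : Flow where
  State := Z.State
  Path := C(unitInterval, Z.Path)
  s := fun γ => Z.s (γ 0)
  t := fun γ => Z.t (γ 0)
  isOpen_preimage_s := fun a =>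
    (Z.isOpen_preimage_s a).preimage (continuous_eval_const (F := C(unitInterval, Z.Path)) (0 : unitInterval))
  isOpen_preimage_t := fun a =>
    (Z.isOpen_preimage_t a).preimage (continuous_eval_const (F := C(unitInterval, Z.Path)) (0 : unitInterval))
  comp := fun γ δ h => ⟨fun u => Z.comp (γ u) (δ u) (Z.composable h u),
    Z.continuous_comp.comp
      (Continuous.subtype_mk (γ.continuous.prodMk δ.continuous) (Z.composable h))⟩
  continuous_comp := by
    apply ContinuousMap.continuous_of_continuous_uncurry
    have h1 : Continuous (fun q : { p : C(unitInterval, Z.Path) × C(unitInterval, Z.Path) //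
        Z.t (p.1 0) = Z.s (p.2 0) } × unitInterval => (q.1.1.1 q.2, q.1.1.2 q.2)) := by
      fun_prop
    exact Z.continuous_comp.comp
      (Continuous.subtype_mk h1 (fun q => Z.composable q.1.2 q.2))
  s_comp := fun x y h => Z.s_comp _ _ _
  t_comp := fun x y h => Z.t_comp _ _ _
  comp_assoc := fun x y z hxy hyz h₁ h₂ => by
    apply ContinuousMap.ext
    intro u
    exact Z.comp_assoc _ _ _ _ _ _ _

/-- Evaluation at time `v`. -/
def cotEv (Z : Flow) (v : unitInterval) : FlowHom (cot Z) Z where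
  toFun0 := _root_.id
  toFunP := fun γ => (show C(unitInterval, Z.Path) from γ) v
  continuous_toFunP := continuous_eval_const (F := C(unitInterval, Z.Path)) v
  s_map x := Z.s_const x v 0
  t_map x := Z.t_const x v 0
  comp_map _ _ _ _ := rfl

/-- The data of a homotopy gives a morphism to the cotensor. -/
def BoxCocone.toCot {X Z : Flow} (d : BoxCocone unitInterval X Z) : FlowHom X (cot Z) where
  toFun0 := d.η0
  toFunP := fun x => (⟨fun u => d.η (u, x), d.continuous_η.comp (Continuous.prodMk_left x)⟩ :
    C(unitInterval, Z.Path))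
  continuous_toFunP := by
    apply ContinuousMap.continuous_of_continuous_uncurry
    exact d.continuous_η.comp continuous_swap
  s_map x := d.s_η 0 x
  t_map x := d.t_η 0 x
  comp_map x y h h' := by
    apply ContinuousMap.ext
    intro u
    exact (d.comp_η u x y h _).symm

theorem cotEv_comp_toCot {X Z : Flow} (d : BoxCocone unitInterval X Z) (v : unitInterval) :
    (cotEv Z v).comp d.toCot = d.atTime v := FlowHom.ext rfl rfl

theorem continuous_cotEv_comp {X Z : Flow} (k : FlowHom X (cot Z)) :
    Continuous (fun q : unitInterval × X.Path => ((cotEv Z q.1).comp k).toFunP q.2) := by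
  have h1 : Continuous (fun q : unitInterval × X.Path =>
      ((k.toFunP q.2 : C(unitInterval, Z.Path)), q.1)) :=
    (k.continuous_toFunP.comp continuous_snd).prodMk continuous_fst
  exact (ContinuousEval.continuous_eval (F := C(unitInterval, Z.Path))).comp h1

/-- A morphism to the cotensor gives the data of a homotopy. -/
def ofCot {X Z : Flow} (k : FlowHom X (cot Z)) : BoxCocone unitInterval X Z where
  η0 := k.toFun0
  η := fun q => ((cotEv Z q.1).comp k).toFunP q.2
  continuous_η := continuous_cotEv_comp k
  s_η u x := ((cotEv Z u).comp k).s_map x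
  t_η u x := ((cotEv Z u).comp k).t_map x
  comp_η u x y h h' := (((cotEv Z u).comp k).comp_map x y h h').symm

theorem ofCot_atTime {X Z : Flow} (k : FlowHom X (cot Z)) (v : unitInterval) :
    (ofCot k).atTime v = (cotEv Z v).comp k := FlowHom.ext rfl rfl

/-- Data of a two-parameter homotopy, as a cocone with values in the cotensor. -/
def BoxCocone.toCot₂ {X Z : Flow} (k0 : X.State → Z.State)
    (K : unitInterval → unitInterval → FlowHom X Z)
    (hk0 : ∀ u v, (K u v).toFun0 = k0)
    (hK : Continuous (fun q : (unitInterval × X.Path) × unitInterval =>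
      (K q.1.1 q.2).toFunP q.1.2)) : BoxCocone unitInterval X (cot Z) where
  η0 := k0
  η := fun q => (⟨fun v => (K q.1 v).toFunP q.2, hK.comp (Continuous.prodMk_right q)⟩ :
    C(unitInterval, Z.Path))
  continuous_η := by
    apply ContinuousMap.continuous_of_continuous_uncurry
    exact hK
  s_η u x := by rw [← hk0 u 0]; exact (K u 0).s_map x
  t_η u x := by rw [← hk0 u 0]; exact (K u 0).t_map x
  comp_η u x y h h' := by
    apply ContinuousMap.ext
    intro v
    exact ((K u v).comp_map x y h _).symm

theorem IsBoxTimes.exists_hom {U : Type} [TopologicalSpace U] {X B Z : Flow}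
    {c : BoxCocone U X B} (hc : IsBoxTimes c) (d : BoxCocone U X Z) :
    ∃ k : FlowHom B Z, k.toFun0 ∘ c.η0 = d.η0 ∧ ∀ u, k.comp (c.atTime u) = d.atTime u := by
  obtain ⟨k, ⟨h0, hP⟩, -⟩ := hc Z d
  exact ⟨k, h0, fun u => FlowHom.ext h0 (funext fun x => congrFun hP (u, x))⟩

theorem IsBoxTimes.hom_ext {X B Z : Flow}
    {c : BoxCocone unitInterval X B} (hc : IsBoxTimes c) {k l : FlowHom B Z}
    (h : ∀ u, k.comp (c.atTime u) = l.comp (c.atTime u)) : k = l := by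
  let d : BoxCocone unitInterval X Z :=
    { η0 := k.toFun0 ∘ c.η0
      η := k.toFunP ∘ c.η
      continuous_η := k.continuous_toFunP.comp c.continuous_η
      s_η := fun u x => (k.comp (c.atTime u)).s_map x
      t_η := fun u x => (k.comp (c.atTime u)).t_map x
      comp_η := fun u x y hh h' => ((k.comp (c.atTime u)).comp_map x y hh h').symm }
  refine (hc Z d).unique ⟨rfl, rfl⟩ ⟨?_, ?_⟩
  · exact (congrArg FlowHom.toFun0 (h 0)).symm
  · funext q
    exact (congrFun (congrArg FlowHom.toFunP (h q.1)) q.2).symm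

theorem pushout_hom_ext {X IX Y If Z : Flow} {i : FlowHom X IX} {f : FlowHom X Y}
    {a : FlowHom IX If} {b : FlowHom Y If}
    (hIf : CategoryTheory.IsPushout (C := Flow) (Z := X) (X := IX) (Y := Y) (P := If) i f a b)
    {k l : FlowHom If Z} (ha : k.comp a = l.comp a) (hb : k.comp b = l.comp b) : k = l :=
  hIf.hom_ext (W := Z) (k := k) (l := l) ha hb

theorem pushout_exists {X IX Y If Z : Flow} {i : FlowHom X IX} {f : FlowHom X Y}
    {a : FlowHom IX If} {b : FlowHom Y If}
    (hIf : CategoryTheory.IsPushout (C := Flow) (Z := X) (X := IX) (Y := Y) (P := If) i f a b)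
    (k : FlowHom IX Z) (l : FlowHom Y Z) (h : k.comp i = l.comp f) :
    ∃ m : FlowHom If Z, m.comp a = k ∧ m.comp b = l :=
  ⟨hIf.desc (W := Z) k l h, hIf.inl_desc (W := Z) k l h, hIf.inr_desc (W := Z) k l h⟩

/-- The constant homotopy. -/
def constCot {Y Z : Flow} (k : FlowHom Y Z) : FlowHom Y (cot Z) where
  toFun0 := k.toFun0
  toFunP := fun x => ContinuousMap.const unitInterval (k.toFunP x)
  continuous_toFunP := ContinuousMap.continuous_const'.comp k.continuous_toFunP
  s_map x := k.s_map x
  t_map x := k.t_map x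
  comp_map x y h h' := by
    apply ContinuousMap.ext
    intro u
    exact k.comp_map x y h _

/-- A two-parameter family of morphisms `X → Z`, constant for `u = 1`, gives a homotopy on the
mapping cylinder. -/
theorem cylinder_homotopy {X Y Z IX If : Flow} {f : FlowHom X Y}
    {c : BoxCocone unitInterval X IX} (hc : IsBoxTimes c)
    {a : FlowHom IX If} {b : FlowHom Y If}
    (hIf : CategoryTheory.IsPushout (C := Flow) (Z := X) (X := IX) (Y := Y) (P := If)
      (c.atTime 1) f a b)
    (l : FlowHom Y Z) (k0 : X.State → Z.State)
    (K : unitInterval → unitInterval → FlowHom X Z)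
    (hk0 : ∀ u v, (K u v).toFun0 = k0)
    (hK : Continuous (fun q : (unitInterval × X.Path) × unitInterval =>
      (K q.1.1 q.2).toFunP q.1.2))
    (hl : ∀ v, K 1 v = l.comp f) :
    ∃ m : FlowHom If (cot Z),
      (∀ u v, ((cotEv Z v).comp m).comp (a.comp (c.atTime u)) = K u v) ∧
      (∀ v, ((cotEv Z v).comp m).comp b = l) := by
  obtain ⟨k, -, hk⟩ := hc.exists_hom (BoxCocone.toCot₂ k0 K hk0 hK)
  have hcomm : k.comp (c.atTime 1) = (constCot l).comp f := by
    rw [hk]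
    refine FlowHom.ext ?_ ?_
    · exact (hk0 1 0).symm.trans (congrArg FlowHom.toFun0 (hl 0))
    · funext x
      apply ContinuousMap.ext
      intro v
      exact congrFun (congrArg FlowHom.toFunP (hl v)) x
  obtain ⟨m, hma, hmb⟩ := pushout_exists hIf k (constCot l) hcomm
  refine ⟨m, fun u v => ?_, fun v => ?_⟩
  · have : ((cotEv Z v).comp m).comp (a.comp (c.atTime u)) =
        (cotEv Z v).comp ((m.comp a).comp (c.atTime u)) := FlowHom.ext rfl rfl
    rw [this, hma, hk]
    exact FlowHom.ext (hk0 u v).symm rfl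
  · rw [FlowHom.comp_assoc, hmb]
    exact FlowHom.ext rfl rfl

theorem cylinder_hom_ext {X Y Z IX If : Flow} {f : FlowHom X Y}
    {c : BoxCocone unitInterval X IX} (hc : IsBoxTimes c)
    {a : FlowHom IX If} {b : FlowHom Y If}
    (hIf : CategoryTheory.IsPushout (C := Flow) (Z := X) (X := IX) (Y := Y) (P := If)
      (c.atTime 1) f a b) {k l : FlowHom If Z}
    (h1 : ∀ u, k.comp (a.comp (c.atTime u)) = l.comp (a.comp (c.atTime u)))
    (h2 : k.comp b = l.comp b) : k = l :=
  pushout_hom_ext hIf (hc.hom_ext fun u => h1 u) h2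

/-- The canonical morphism to the mapping cylinder is an S-cofibration. -/
theorem cylinder_cofibration {X Y IX If : Flow} {f : FlowHom X Y}
    {c : BoxCocone unitInterval X IX} (hc : IsBoxTimes c)
    {a : FlowHom IX If} {b : FlowHom Y If}
    (hIf : CategoryTheory.IsPushout (C := Flow) (Z := X) (X := IX) (Y := Y) (P := If)
      (c.atTime 1) f a b) : IsSCofibration (a.comp (c.atTime 0)) := by
  intro IA IX' cA cX hA hX Z g H hH
  have hw : a.comp (c.atTime 1) = b.comp f := hIf.w
  have h01 : (0 : ℝ) ≤ 1 := zero_le_one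
  -- the glued homotopy, parametrized by the real line
  let G : ℝ → FlowHom X Z := fun w =>
    if 0 ≤ w then g.comp (a.comp (c.atTime (Set.projIcc 0 1 h01 w)))
    else H.comp (cA.atTime (Set.projIcc 0 1 h01 (-w)))
  have hGpos : ∀ w, 0 ≤ w → G w = g.comp (a.comp (c.atTime (Set.projIcc 0 1 h01 w))) :=
    fun w hw => if_pos hw
  have hGneg : ∀ w, w ≤ 0 → G w = H.comp (cA.atTime (Set.projIcc 0 1 h01 (-w))) := by
    intro w hw
    rcases hw.lt_or_eq with h | h
    · exact if_neg (not_le.2 h)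
    · subst h
      rw [hGpos 0 le_rfl, neg_zero, Set.projIcc_left]
      exact hH.symm
  have hG0 : ∀ w, (G w).toFun0 = g.toFun0 ∘ a.toFun0 ∘ c.η0 := by
    intro w
    rcases le_total 0 w with h | h
    · rw [hGpos w h]; rfl
    · rw [hGneg w h]; exact congrArg FlowHom.toFun0 hH
  have hGcont : Continuous (fun q : ℝ × X.Path => (G q.1).toFunP q.2) := by
    have e : (fun q : ℝ × X.Path => (G q.1).toFunP q.2) = fun q =>
        if 0 ≤ q.1 then g.toFunP (a.toFunP (c.η (Set.projIcc 0 1 h01 q.1, q.2)))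
        else H.toFunP (cA.η (Set.projIcc 0 1 h01 (-q.1), q.2)) := by
      funext q
      split_ifs with h
      · rw [hGpos _ h]; rfl
      · rw [hGneg _ (not_le.1 h).le]; rfl
    rw [e]
    have hc1 : Continuous (fun q : ℝ × X.Path => (Set.projIcc 0 1 h01 q.1, q.2)) :=
      (continuous_projIcc.comp continuous_fst).prodMk continuous_snd
    have hc2 : Continuous (fun q : ℝ × X.Path => (Set.projIcc 0 1 h01 (-q.1), q.2)) :=
      (continuous_projIcc.comp continuous_fst.neg).prodMk continuous_snd
    refine Continuous.if_le
      (g.continuous_toFunP.comp (a.continuous_toFunP.comp (c.continuous_η.comp hc1)))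
      (H.continuous_toFunP.comp (cA.continuous_η.comp hc2)) continuous_const continuous_fst ?_
    rintro ⟨w, x⟩ h
    have h' : w = 0 := h.symm
    subst h'
    have := congrFun (congrArg FlowHom.toFunP ((hGpos 0 le_rfl).symm.trans (hGneg 0 le_rfl))) x
    exact this
  obtain ⟨m, hm1, hm2⟩ := cylinder_homotopy hc hIf (g.comp b) (g.toFun0 ∘ a.toFun0 ∘ c.η0)
    (fun u v => G ((u : ℝ) - v * (1 - u))) (fun u v => hG0 _)
    (by
      have : Continuous (fun q : (unitInterval × X.Path) × unitInterval =>
          (((q.1.1 : ℝ) - q.2 * (1 - q.1.1)), q.1.2)) := by fun_prop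
      exact hGcont.comp this)
    (by
      intro v
      have : ((1 : unitInterval) : ℝ) - v * (1 - (1 : unitInterval)) = 1 := by simp
      simp only [this]
      rw [hGpos 1 zero_le_one, Set.projIcc_right, FlowHom.comp_assoc, ← hw]
      rfl)
  obtain ⟨Hbar, -, hHbar⟩ := hX.exists_hom (ofCot m)
  refine ⟨Hbar, fun v => ?_, ?_⟩
  · rw [← FlowHom.comp_assoc, hHbar, ofCot_atTime, hm1]
    have : ((0 : unitInterval) : ℝ) - v * (1 - (0 : unitInterval)) = -v := by simp
    simp only [this]
    rw [hGneg _ (neg_nonpos.2 v.2.1), neg_neg, Set.projIcc_val]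
  · rw [hHbar, ofCot_atTime]
    refine cylinder_hom_ext hc hIf (fun u => ?_) (hm2 0)
    rw [hm1]
    have : (u : ℝ) - (0 : unitInterval) * (1 - u) = u := by simp
    simp only [this]
    rw [hGpos _ u.2.1, Set.projIcc_val]

/-- The retraction of the mapping cylinder is an S-homotopy equivalence. -/
theorem cylinder_equiv {X Y IX If : Flow} {f : FlowHom X Y}
    {c : BoxCocone unitInterval X IX} (hc : IsBoxTimes c)
    {a : FlowHom IX If} {b : FlowHom Y If}
    (hIf : CategoryTheory.IsPushout (C := Flow) (Z := X) (X := IX) (Y := Y) (P := If)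
      (c.atTime 1) f a b) {r : FlowHom If Y} (hra : ∀ u, r.comp (a.comp (c.atTime u)) = f)
    (hrb : r.comp b = FlowHom.id Y) : IsSHomotopyEquiv r := by
  have hw : a.comp (c.atTime 1) = b.comp f := hIf.w
  refine ⟨b, ⟨fun _ => FlowHom.id Y, hrb.symm, rfl, continuous_fst, continuous_fst⟩, ?_⟩
  obtain ⟨m, hm1, hm2⟩ := cylinder_homotopy hc hIf b (a.toFun0 ∘ c.η0)
    (fun u v => a.comp (c.atTime (max u (unitInterval.symm v)))) (fun u v => rfl)
    (by
      have : Continuous (fun q : (unitInterval × X.Path) × unitInterval =>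
          (max q.1.1 (unitInterval.symm q.2), q.1.2)) := by fun_prop
      exact a.continuous_toFunP.comp (c.continuous_η.comp this))
    (by
      intro v
      have : max 1 (unitInterval.symm v) = 1 := max_eq_left unitInterval.le_one'
      simp only [this]
      exact hw)
  refine ⟨fun v => (cotEv If v).comp m, ?_, ?_, ?_, ?_⟩
  · refine cylinder_hom_ext hc hIf (fun u => ?_) ?_
    · rw [hm1, FlowHom.comp_assoc, hra, ← hw, unitInterval.symm_zero,
        max_eq_right unitInterval.le_one']
    · rw [hm2, FlowHom.comp_assoc, hrb]
      exact FlowHom.ext rfl rfl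
  · refine cylinder_hom_ext hc hIf (fun u => ?_) ?_
    · rw [hm1, unitInterval.symm_one, max_eq_left unitInterval.nonneg']
      exact FlowHom.ext rfl rfl
    · rw [hm2]
      exact FlowHom.ext rfl rfl
  · exact (continuous_cotEv_comp m).comp continuous_swap
  · exact (continuous_of_discreteTopology (f := m.toFun0)).comp continuous_fst

/-- the mapping cylinder factorization.  Let `f : X → Y` be a morphism
of flows and let `I_f` be its mapping cylinder, i.e. the pushout in `Flow` of
`[0,1] ⊠ X ← {1} ⊠ X → Y` (the flow `{1} ⊠ X` being canonically isomorphic to `X`,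
the left map is `x ↦ 1 ⊠ x` and the right one is `f`).  Then the canonical morphism
`X → I_f`, `x ↦ 0 ⊠ x`, is an S-cofibration, the canonical morphism `r : I_f → Y`
(induced by the identity of `Y` and by `u ⊠ x ↦ f(x)`) is an S-homotopy equivalence,
and `f = r ∘ (X → I_f)`.  In particular every morphism of flows factors as an
S-cofibration followed by an S-homotopy equivalence. -/
theorem mappingCylinder_factorization (X Y : Flow) (f : FlowHom X Y)
    (IX : Flow) (c : BoxCocone unitInterval X IX) (hc : IsBoxTimes c)
    -- `If` is the mapping cylinder, pushout of `[0,1] ⊠ X ← X → Y`: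
    (If : Flow) (a : FlowHom IX If) (b : FlowHom Y If)
    (hIf : CategoryTheory.IsPushout (C := Flow) (Z := X) (X := IX) (Y := Y) (P := If)
      (c.atTime 1) f a b)
    -- the projection `[0,1] ⊠ X → Y`, `u ⊠ x ↦ f x`:
    (p : FlowHom IX Y) (hp0 : p.toFun0 ∘ c.η0 = f.toFun0)
    (hpP : ∀ u x, p.toFunP (c.η (u, x)) = f.toFunP x)
    -- the canonical retraction `r : I_f → Y`:
    (r : FlowHom If Y) (hra : r.comp a = p) (hrb : r.comp b = FlowHom.id Y) :
    IsSCofibration (a.comp (c.atTime 0)) ∧ IsSHomotopyEquiv r ∧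
      r.comp (a.comp (c.atTime 0)) = f := by
  have hr : ∀ u, r.comp (a.comp (c.atTime u)) = f := by
    intro u
    rw [← FlowHom.comp_assoc, hra]
    exact FlowHom.ext hp0 (funext fun x => hpP u x)
  exact ⟨cylinder_cofibration hc hIf, cylinder_equiv hc hIf hr hrb, hr 0⟩

end Gaucher
end
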